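/- Let X ⊂ int(𝔸) be an f-invariant essential annular continuum. Assume there exists ρ < 0 such that for all points x, y ∈ X̃ accessible from Ũ₊ one has k(f̃ⁿ(x), y)/n → ρ as n → ∞, assume inf ρ_mes(f̃, X) > 0, and assume (f̃(x))₁ ≥ (x)₁ + 1 for every x ∈ X̃. Then (V)₁ is not bounded from below, i.e. inf (V)₁ = −∞. -/

import Mathlib

open Set Function MeasureTheory Filter Topology

noncomputable section

/-- The vertical fiber `[-1,1]`. -/
abbrev II : Set ℝ := Set.Icc (-1 : ℝ) 1

/-- The universal cover `ℝ × [-1,1]` of the annulus. -/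
abbrev Strip : Type := ℝ × II

/-- The compact annulus `(ℝ/ℤ) × [-1,1]`. -/
abbrev Ann : Type := AddCircle (1 : ℝ) × II

/-- The covering projection `π`. -/
def pr (z : Strip) : Ann := ((z.1 : AddCircle (1 : ℝ)), z.2)

/-- The deck transformation `T^k`. -/
def shiftPt (k : ℤ) (z : Strip) : Strip := (z.1 + k, z.2)

/-- `S + k`, the image of `S` under `T^k`. -/
def shiftSet (k : ℤ) (S : Set Strip) : Set Strip := shiftPt k '' S

/-- `f` is isotopic to the identity. -/
def IsotopicToId (f : Ann → Ann) : Prop :=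
  ∃ H : ℝ → Ann → Ann, Continuous (fun p : ℝ × Ann => H p.1 p.2) ∧
    (∀ t : ℝ, Function.Bijective (H t)) ∧ H 0 = id ∧ H 1 = f

/-- `F` is a lift of `f` commuting with the deck transformation. -/
def IsLift (f : Ann → Ann) (F : Strip → Strip) : Prop :=
  (∀ z, pr (F z) = f (pr z)) ∧ (∀ z, F (shiftPt 1 z) = shiftPt 1 (F z))

/-- `X` is an essential annular continuum with complementary components `Um`, `Up`. -/
structure IsEAC (X Um Up : Set Ann) : Prop where
  compact : IsCompact X
  connected : IsConnected X
  inInterior : ∀ p ∈ X, ((p.2 : ℝ)) ∈ Set.Ioo (-1 : ℝ) 1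
  hUm : Um = connectedComponentIn Xᶜ ((0 : AddCircle (1 : ℝ)), ⟨-1, le_rfl, by norm_num⟩)
  hUp : Up = connectedComponentIn Xᶜ ((0 : AddCircle (1 : ℝ)), ⟨1, by norm_num, le_rfl⟩)
  cover : Xᶜ = Um ∪ Up
  ne : Um ≠ Up

/-- An arc `γ : [0,1] → U ∪ {p}` with `γ([0,1)) ⊂ U` and `γ(1) = p`. -/
def IsArcTo (U : Set Strip) (γ : unitInterval → Strip) (p : Strip) : Prop :=
  Continuous γ ∧ Function.Injective γ ∧ (∀ t, t ≠ 1 → γ t ∈ U) ∧ γ 1 = p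

/-- `p` is accessible from `U`. -/
def AccFrom (U : Set Strip) (p : Strip) : Prop := ∃ γ, IsArcTo U γ p

/-- The order `≺` on accessible points, with access arcs starting on `ℝ × {b}`. -/
def PrecB (b : ℝ) (U : Set Strip) (x x' : Strip) : Prop :=
  ∃ γ γ' : unitInterval → Strip,
    IsArcTo U γ x ∧ IsArcTo U γ' x' ∧
    ((γ 0).2 : ℝ) = b ∧ ((γ' 0).2 : ℝ) = b ∧
    Disjoint (range γ) (range γ') ∧ (γ 0).1 < (γ' 0).1

/-- `k = k(x,y)` is the unique integer with `T^k(y) ⪯ x ≺ T^{k+1}(y)`. -/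
def AccIdxB (b : ℝ) (U : Set Strip) (x y : Strip) (k : ℤ) : Prop :=
  (shiftPt k y = x ∨ PrecB b U (shiftPt k y) x) ∧ PrecB b U x (shiftPt (k + 1) y)

/-- `ρ` is the prime end rotation number of the lift `F` as seen from `U`
(access arcs starting at height `b`): `k(Fⁿ(x), y)/n → ρ` for all accessible `x, y`. -/
def PrimeEndRotB (b : ℝ) (U Xt : Set Strip) (F : Strip → Strip) (ρ : ℝ) : Prop :=
  ∀ x ∈ Xt, ∀ y ∈ Xt, AccFrom U x → AccFrom U y →
    ∀ k : ℕ → ℤ, (∀ n : ℕ, AccIdxB b U (F^[n] x) y (k n)) →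
      Tendsto (fun n : ℕ => (k n : ℝ) / (n : ℝ)) atTop (𝓝 ρ)

/-- The measure-theoretic rotation set `ρ_mes(g̃, X)`, where `φ` is the displacement
function of the lift `g̃` (pushed down to the annulus). -/
def rotMes (g : Ann → Ann) (φ : Ann → ℝ) (X : Set Ann) : Set ℝ :=
  {r | ∃ μ : Measure Ann, IsProbabilityMeasure μ ∧ Measure.map g μ = μ ∧
    μ Xᶜ = 0 ∧ ∫ a, φ a ∂μ = r}

/-- A point in the interior of the top boundary segment `(0,1) × {1}`. -/
def topSeg : Strip := ((1 : ℝ) / 2, ⟨1, by norm_num, le_rfl⟩)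

/-- `β' = β ∖ {x₀} = {0} × (η, 1]`. -/
def betaP (η : ℝ) : Set Strip := {z : Strip | z.1 = 0 ∧ η < (z.2 : ℝ)}

/-- `η = max{y : (0,y) ∈ X̃}`. -/
def etaSpec (Xt : Set Strip) (η : ℝ) : Prop :=
  IsGreatest {y : ℝ | ∃ z ∈ Xt, z.1 = 0 ∧ (z.2 : ℝ) = y} η

/-- The fundamental region `V`: the closure, relative to `Ũ₊`, of the connected
component of `Ũ₊ ∖ (β' ∪ (β' + 1))` containing the segment `(0,1) × {1}`. -/
def Vset (Utp : Set Strip) (η : ℝ) : Set Strip :=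
  Utp ∩ closure (connectedComponentIn (Utp \ (betaP η ∪ shiftSet 1 (betaP η))) topSeg)

/-- A hair of `W`: an arc in `W` starting on `ℝ × {1}`. -/
def IsHair (W : Set Strip) (γ : unitInterval → Strip) : Prop :=
  Continuous γ ∧ Function.Injective γ ∧ ((γ 0).2 : ℝ) = 1 ∧ ∀ t, γ t ∈ W

/-- `(γ)₁`, the projection of the image of `γ` to the first coordinate. -/
def proj1 (γ : unitInterval → Strip) : Set ℝ := range fun t => (γ t).1

/-- `(V + k)⁻ = ⋃_{j ≤ k} (V + j)`. -/
def VMinus (k : ℤ) (V : Set Strip) : Set Strip := ⋃ j ∈ Iic k, shiftSet j V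

/-- `(V + k)⁺ = ⋃_{j ≥ k} (V + j)`. -/
def VPlus (k : ℤ) (V : Set Strip) : Set Strip := ⋃ j ∈ Ici k, shiftSet j V

/-- A crosscut of `Ũ₊`: an arc with endpoints on `X̃` and interior in `Ũ₊`. -/
def IsCrosscut (Utp Xt : Set Strip) (c : unitInterval → Strip) : Prop :=
  Continuous c ∧ Function.Injective c ∧ c 0 ∈ Xt ∧ c 1 ∈ Xt ∧
    ∀ t, t ≠ 0 → t ≠ 1 → c t ∈ Utp

/-- `F^n` for `n : ℤ`. -/
def iterZ (F : Strip ≃ₜ Strip) (n : ℤ) : Strip → Strip := fun z => (F.toEquiv ^ n) z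

end

namespace VU

instance instLPCII : LocallyPathConnectedSpace II :=
  Convex.locallyPathConnectedSpace ℝ (convex_Icc (-1 : ℝ) 1)

instance instLPCCirc : LocallyPathConnectedSpace (AddCircle (1 : ℝ)) :=
  inferInstanceAs (LocallyPathConnectedSpace (Quotient _))

/-- Logarithms exist on the plane. -/
lemma exists_log (Φ : ℝ × ℝ → ℂ) (hc : Continuous Φ) (h0 : ∀ z, Φ z ≠ 0) :
    ∃ v : ℝ × ℝ → ℂ, Continuous v ∧ ∀ z, Complex.exp (v z) = Φ z := by
  rcases Complex.isCoveringMapOn_exp.existsUnique_continuousMap_lifts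
    ⟨Φ, hc⟩ (a₀ := (0, 0)) (Complex.exp_log (h0 (0, 0))) (fun x => h0 x) with ⟨v, ⟨-, hv⟩, -⟩
  exact ⟨v, v.continuous, fun z => congrFun hv z⟩

/-- A continuous logarithm of `1` on a preconnected set is constant. -/
lemma exp_one_const {α : Type*} [TopologicalSpace α] {S : Set α} (hS : IsPreconnected S)
    {g : α → ℂ} (hg : ContinuousOn g S) (h1 : ∀ x ∈ S, Complex.exp (g x) = 1)
    {a b : α} (ha : a ∈ S) (hb : b ∈ S) : g a = g b := by
  have hn : ∀ x ∈ S, ∃ n : ℤ, g x = n * (2 * Real.pi * Complex.I) := fun x hx =>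
    Complex.exp_eq_one_iff.1 (h1 x hx)
  let r : α → ℝ := fun x => (g x).im / (2 * Real.pi)
  have hpi : (2 * Real.pi) ≠ 0 := by positivity
  have hr : ContinuousOn r S := (Complex.continuous_im.comp_continuousOn hg).div_const _
  have hrn : ∀ x ∈ S, ∀ n : ℤ, g x = n * (2 * Real.pi * Complex.I) → r x = n := by
    intro x hx n h
    simp only [r, h]
    simp
  have hsub : (r '' S).Subsingleton := by
    have hp : IsPreconnected (r '' S) := hS.image r hr
    have hsub : r '' S ⊆ Set.range ((↑) : ℤ → ℝ) := by
      rintro _ ⟨x, hx, rfl⟩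
      obtain ⟨n, hn⟩ := hn x hx
      exact ⟨n, (hrn x hx n hn).symm⟩
    have htd : IsTotallyDisconnected (Set.range ((↑) : ℤ → ℝ)) :=
      (Set.countable_range _).isTotallyDisconnected
    exact htd _ hsub hp
  obtain ⟨n, hna⟩ := hn a ha
  obtain ⟨m, hmb⟩ := hn b hb
  have := hsub (mem_image_of_mem r ha) (mem_image_of_mem r hb)
  rw [hrn a ha n hna, hrn b hb m hmb] at this
  have : n = m := by exact_mod_cast this
  rw [hna, hmb, this]

/-- Unicoherence of the strip. -/
lemma inter_preconn (N U : Set Strip) (hN : IsOpen N) (hU : IsOpen U)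
    (hNc : IsPreconnected N) (hUc : IsPreconnected U) (hun : N ∪ U = univ)
    (P Q : Set Strip) (hP : IsOpen P) (hQ : IsOpen Q) (hPQ : Disjoint P Q)
    (hcov : N ∩ U = P ∪ Q) (hPn : P.Nonempty) (hQn : Q.Nonempty) : False := by
  classical
  obtain ⟨u, hu0, hu1, -⟩ := exists_continuous_zero_one_of_isClosed
    (s := Nᶜ) (t := Uᶜ) hN.isClosed_compl hU.isClosed_compl (by
      rw [Set.disjoint_left]
      intro x hx hx'
      have : x ∈ N ∪ U := hun ▸ mem_univ x
      rcases this with h | h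
      · exact hx h
      · exact hx' h)
  have huc : Continuous u := u.continuous
  have hfr : ∀ z ∈ frontier P, z ∈ Nᶜ ∪ Uᶜ := by
    intro z hz
    by_contra hcon
    have hz' : z ∈ N ∩ U := by
      simp only [mem_union, mem_compl_iff, not_or, not_not] at hcon
      exact hcon
    rw [hcov] at hz'
    rw [hP.frontier_eq] at hz
    rcases hz' with h | h
    · exact hz.2 h
    · have := hPQ.symm.closure_right hQ
      exact (Set.disjoint_left.1 this h) hz.1
  have huval : ∀ z ∈ Nᶜ ∪ Uᶜ, u z = 0 ∨ u z = 1 := by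
    rintro z (h | h)
    · left; exact hu0 h
    · right; exact hu1 h
  let e : Strip → ℂ := fun z => Complex.exp ((u z : ℂ) * (2 * Real.pi * Complex.I))
  have hec : Continuous e := by
    have : Continuous fun z => ((u z : ℝ) : ℂ) := Complex.continuous_ofReal.comp huc
    exact Complex.continuous_exp.comp (this.mul continuous_const)
  have he1 : ∀ z ∈ Nᶜ ∪ Uᶜ, e z = 1 := by
    intro z hz
    rcases huval z hz with h | h <;> simp [e, h, Complex.exp_two_pi_mul_I]
  let h : Strip → ℂ := fun z => if z ∈ P then e z else 1
  have hhc : Continuous h := by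
    refine Continuous.if (fun a ha => he1 a (hfr a ha)) hec continuous_const
  let ret : ℝ × ℝ → Strip := fun z => (z.1, Set.projIcc (-1 : ℝ) 1 (by norm_num) z.2)
  have hret : Continuous ret := by
    refine continuous_fst.prodMk ?_
    exact continuous_projIcc.comp continuous_snd
  obtain ⟨v0, hv0c, hv0⟩ := exists_log (fun z => h (ret z)) (hhc.comp hret) (by
    intro z
    simp only [h]
    split_ifs
    · exact Complex.exp_ne_zero _
    · exact one_ne_zero)
  let v : Strip → ℂ := fun z => v0 (z.1, (z.2 : ℝ))
  have hvc : Continuous v := by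
    refine hv0c.comp (continuous_fst.prodMk (continuous_subtype_val.comp continuous_snd))
  have hv : ∀ z, Complex.exp (v z) = h z := by
    intro z
    have := hv0 (z.1, (z.2 : ℝ))
    simp only [ret, projIcc_val] at this
    exact this
  -- the two branches
  let w1 : Strip → ℂ := fun z => if z ∈ P then (u z : ℂ) * (2 * Real.pi * Complex.I) else 0
  let w2 : Strip → ℂ := fun z => if z ∈ P then ((u z : ℂ) - 1) * (2 * Real.pi * Complex.I) else 0
  have hcu : Continuous fun z => ((u z : ℝ) : ℂ) := Complex.continuous_ofReal.comp huc
  have hw1 : ContinuousOn w1 U := by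
    refine ContinuousOn.if (fun a ha => ?_) ?_ continuousOn_const
    · have := hfr a ha.2
      rcases this with h' | h'
      · simp [hu0 h']
      · exact absurd ha.1 h'
    · exact (hcu.mul continuous_const).continuousOn
  have hw2 : ContinuousOn w2 N := by
    refine ContinuousOn.if (fun a ha => ?_) ?_ continuousOn_const
    · have := hfr a ha.2
      rcases this with h' | h'
      · exact absurd ha.1 h'
      · simp [hu1 h']
    · exact ((hcu.sub continuous_const).mul continuous_const).continuousOn
  have hew1 : ∀ z, Complex.exp (w1 z) = h z := by
    intro z
    simp only [w1, h]
    split_ifs <;> simp [e]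
  have hew2 : ∀ z, Complex.exp (w2 z) = h z := by
    intro z
    simp only [w2, h]
    split_ifs
    · simp only [e]
      rw [sub_mul, one_mul, Complex.exp_sub, Complex.exp_two_pi_mul_I, div_one]
    · simp
  have hh0 : ∀ z, h z ≠ 0 := fun z => hv z ▸ Complex.exp_ne_zero _
  obtain ⟨p, hp⟩ := hPn
  obtain ⟨q, hq⟩ := hQn
  have hpm : p ∈ N ∩ U := hcov ▸ Or.inl hp
  have hqm : q ∈ N ∩ U := hcov ▸ Or.inr hq
  have hqP : q ∉ P := fun h' => Set.disjoint_left.1 hPQ h' hq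
  have e1 := exp_one_const hUc (hvc.continuousOn.sub hw1) (fun x _ => by
    simp [Complex.exp_sub, hv, hew1, hh0 x]) hpm.2 hqm.2
  have e2 := exp_one_const hNc (hvc.continuousOn.sub hw2) (fun x _ => by
    simp [Complex.exp_sub, hv, hew2, hh0 x]) hpm.1 hqm.1
  simp only [Pi.sub_apply, w1, w2, hp, hqP, if_true, if_false] at e1 e2
  have : (2 * Real.pi * Complex.I : ℂ) = 0 := by linear_combination e2 - e1
  exact Complex.two_pi_I_ne_zero this


lemma pr_cont : Continuous pr := by
  unfold pr
  exact ((AddCircle.continuous_mk' (1 : ℝ)).comp continuous_fst).prodMk continuous_snd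

lemma pr_open : IsOpenMap pr := by
  have h1 : IsOpenMap ((↑) : ℝ → AddCircle (1 : ℝ)) := QuotientAddGroup.isOpenMap_coe
  exact h1.prodMap IsOpenMap.id

lemma pr_surj : Function.Surjective pr := by
  rintro ⟨a, y⟩
  induction a using QuotientAddGroup.induction_on with
  | H x => exact ⟨(x, y), rfl⟩

lemma pr_shift (k : ℤ) (z : Strip) : pr (shiftPt k z) = pr z := by
  unfold pr shiftPt
  simp

lemma shift_of_pr {z w : Strip} (h : pr z = pr w) : ∃ k : ℤ, w = shiftPt k z := by
  unfold pr at h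
  simp only [Prod.mk.injEq] at h
  obtain ⟨h1, h2⟩ := h
  rw [eq_comm, QuotientAddGroup.eq] at h1
  obtain ⟨n, hn⟩ := AddSubgroup.mem_zmultiples_iff.1 h1
  refine ⟨-n, ?_⟩
  unfold shiftPt
  ext
  · simp at hn ⊢
    linarith
  · simp [h2]

lemma shift_cont (k : ℤ) : Continuous (shiftPt k) := by
  unfold shiftPt
  exact (continuous_fst.add continuous_const).prodMk continuous_snd

lemma shift_shift (k l : ℤ) (z : Strip) : shiftPt k (shiftPt l z) = shiftPt (l + k) z := by
  unfold shiftPt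
  simp [add_assoc]

lemma shift_zero (z : Strip) : shiftPt 0 z = z := by
  unfold shiftPt
  simp

/-- the preimage of an open connected set containing an essential boundary circle is connected -/
lemma pre_conn (O : Set Ann) (hO : IsOpen O) (hc : IsPreconnected O) (b : II)
    (hb : ∀ a : AddCircle (1 : ℝ), (a, b) ∈ O) : IsPreconnected (pr ⁻¹' O) := by
  set Ot := pr ⁻¹' O with hOt
  have hOto : IsOpen Ot := hO.preimage pr_cont
  have hline : ∀ x : ℝ, ((x, b) : Strip) ∈ Ot := fun x => hb _
  set D := connectedComponentIn Ot ((0, b) : Strip) with hD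
  have hDo : IsOpen D := hOto.connectedComponentIn
  have hDsub : D ⊆ Ot := connectedComponentIn_subset _ _
  have hlineD : ∀ x : ℝ, ((x, b) : Strip) ∈ D := by
    have hpc : IsPreconnected (range fun x : ℝ => ((x, b) : Strip)) :=
      isPreconnected_range (by fun_prop)
    have := hpc.subset_connectedComponentIn (x := ((0, b) : Strip)) ⟨0, rfl⟩
      (by rintro _ ⟨x, rfl⟩; exact hline x)
    intro x
    exact this ⟨x, rfl⟩
  have hDs : ∀ k : ℤ, ∀ z ∈ D, shiftPt k z ∈ D := by
    intro k z hz
    have hpc : IsPreconnected (shiftPt k '' D) :=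
      isPreconnected_connectedComponentIn.image _ (shift_cont k).continuousOn
    have hsub := hpc.subset_connectedComponentIn (F := Ot) (x := shiftPt k (0, b))
      (mem_image_of_mem _ (hlineD 0)) (by
        rintro _ ⟨w, hw, rfl⟩
        change pr _ ∈ O
        rw [pr_shift]
        exact hDsub hw)
    have hm : shiftPt k (0, b) ∈ D := hlineD _
    rw [← connectedComponentIn_eq hm] at hsub
    exact hsub (mem_image_of_mem _ hz)
  have hRo : IsOpen (Ot \ D) := by
    rw [isOpen_iff_mem_nhds]
    intro z hz
    have ho : IsOpen (connectedComponentIn Ot z) := hOto.connectedComponentIn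
    refine mem_of_superset (ho.mem_nhds (mem_connectedComponentIn hz.1)) ?_
    intro w hw
    refine ⟨connectedComponentIn_subset _ _ hw, fun hwD => hz.2 ?_⟩
    have h1 := connectedComponentIn_eq hw
    have h2 := connectedComponentIn_eq hwD
    rw [← hD] at h2
    rw [h2, ← h1]
    exact mem_connectedComponentIn hz.1
  have key : Ot \ D = ∅ := by
    by_contra hne
    obtain ⟨z, hz⟩ := nonempty_iff_ne_empty.2 hne
    obtain ⟨p, hp⟩ := hc (pr '' D) (pr '' (Ot \ D)) (pr_open _ hDo) (pr_open _ hRo) (by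
      intro p hp
      obtain ⟨w, rfl⟩ := pr_surj p
      by_cases hw : w ∈ D
      · exact Or.inl ⟨w, hw, rfl⟩
      · exact Or.inr ⟨w, ⟨hp, hw⟩, rfl⟩)
      ⟨pr (0, b), hb _, ⟨_, hlineD 0, rfl⟩⟩ ⟨pr z, hz.1, ⟨z, hz, rfl⟩⟩
    obtain ⟨-, ⟨w, hw, rfl⟩, ⟨w', hw', he⟩⟩ := hp
    obtain ⟨k, hk⟩ := shift_of_pr he.symm
    exact hw'.2 (hk ▸ hDs k w hw)
  have : Ot = D := by
    apply Subset.antisymm _ hDsub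
    exact sdiff_eq_empty.1 key
  rw [this]
  exact isPreconnected_connectedComponentIn

/-- winding numbers of loops -/
def HasWind (φ : ℝ → ℂ) (c : ℂ) : Prop :=
  ∃ l : ℝ → ℂ, Continuous l ∧ (∀ t, Complex.exp (l t) = φ t) ∧ l 1 - l 0 = c

lemma HasWind.unique {φ : ℝ → ℂ} {c c' : ℂ} (h : HasWind φ c) (h' : HasWind φ c') : c = c' := by
  obtain ⟨l, hl, he, rfl⟩ := h
  obtain ⟨l', hl', he', rfl⟩ := h'
  have := exp_one_const isPreconnected_univ (hl.sub hl').continuousOn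
    (fun x _ => by
      rw [Pi.sub_apply, Complex.exp_sub, he, he', div_self]
      rw [← he]
      exact Complex.exp_ne_zero _) (mem_univ 1) (mem_univ 0)
  simp only [Pi.sub_apply] at this
  linear_combination this

lemma HasWind.homotopy {Φ : ℝ × ℝ → ℂ} (hc : Continuous Φ) (h0 : ∀ z, Φ z ≠ 0)
    (hper : ∀ t, Φ (1, t) = Φ (0, t)) {c : ℂ} {s t : ℝ} (h : HasWind (fun x => Φ (x, s)) c) :
    HasWind (fun x => Φ (x, t)) c := by
  obtain ⟨v, hv, hev⟩ := exists_log Φ hc h0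
  have hs : HasWind (fun x => Φ (x, s)) (v (1, s) - v (0, s)) :=
    ⟨fun x => v (x, s), by fun_prop, fun x => hev _, rfl⟩
  have := hs.unique h
  refine ⟨fun x => v (x, t), by fun_prop, fun x => hev _, ?_⟩
  rw [← this]
  refine exp_one_const (g := fun t => v (1, t) - v (0, t)) isPreconnected_univ
    (Continuous.continuousOn (by fun_prop))
    (fun x _ => ?_) (mem_univ t) (mem_univ s)
  rw [Complex.exp_sub, hev, hev, hper, div_self (h0 _)]

/-- the embedding of the annulus in the complex plane -/
noncomputable def emb (p : Ann) : ℂ := (((p.2 : ℝ) + 2 : ℝ) : ℂ) * (AddCircle.toCircle p.1 : ℂ)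

lemma emb_cont : Continuous emb := by
  unfold emb
  have h1 : Continuous fun p : Ann => (((p.2 : ℝ) + 2 : ℝ) : ℂ) :=
    Complex.continuous_ofReal.comp ((continuous_subtype_val.comp continuous_snd).add
      continuous_const)
  have h2 : Continuous fun p : Ann => (AddCircle.toCircle p.1 : ℂ) :=
    continuous_subtype_val.comp (AddCircle.continuous_toCircle.comp continuous_fst)
  exact h1.mul h2

lemma emb_norm (p : Ann) : ‖emb p‖ = (p.2 : ℝ) + 2 := by
  unfold emb
  rw [norm_mul, Circle.norm_coe, mul_one, Complex.norm_real, Real.norm_eq_abs, abs_of_pos]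
  have := p.2.2.1
  linarith

lemma emb_inj : Function.Injective emb := by
  intro p q h
  have hn : (p.2 : ℝ) = q.2 := by
    have := congrArg norm h
    rw [emb_norm, emb_norm] at this
    linarith
  have h2 : p.2 = q.2 := Subtype.ext hn
  have h1 : p.1 = q.1 := by
    unfold emb at h
    rw [hn] at h
    have hne : ((((q.2 : ℝ) + 2 : ℝ)) : ℂ) ≠ 0 := by
      have := q.2.2.1
      have h3 : (q.2 : ℝ) + 2 ≠ 0 := by linarith
      exact_mod_cast h3
    have := mul_left_cancel₀ hne h
    exact AddCircle.injective_toCircle one_ne_zero (Circle.coe_injective this)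
  exact Prod.ext h1 h2

/-- top and bottom heights -/
def top1 : II := ⟨1, by norm_num, le_rfl⟩
def bot1 : II := ⟨-1, le_rfl, by norm_num⟩

lemma coe_one_eq : ((1 : ℝ) : AddCircle (1 : ℝ)) = ((0 : ℝ) : AddCircle (1 : ℝ)) := by
  simp

lemma no_swap (H : ℝ → Ann → Ann) (hH : Continuous (fun p : ℝ × Ann => H p.1 p.2))
    (hinj : ∀ t, Function.Injective (H t)) (h0 : H 0 = id)
    (U : Set Ann) (hUo : IsOpen U) (hU : IsPreconnected U) (htop : (0, top1) ∈ U)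
    (hbot : H 1 (0, bot1) ∈ U) (hdis : ∀ a, H 1 (a, top1) ∉ U) : False := by
  have hmk : Continuous ((↑) : ℝ → AddCircle (1 : ℝ)) := AddCircle.continuous_mk' 1
  -- first loop
  have w0 : HasWind (fun x => 3 * Complex.exp (2 * Real.pi * x * Complex.I))
      (2 * Real.pi * Complex.I) := by
    refine ⟨fun x => Complex.log 3 + 2 * Real.pi * x * Complex.I, by fun_prop, fun t => ?_, ?_⟩
    · rw [Complex.exp_add, Complex.exp_log (by norm_num)]
    · simp
  have htopemb : ∀ x : ℝ, emb ((x : AddCircle (1 : ℝ)), top1)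
      = 3 * Complex.exp (2 * Real.pi * x * Complex.I) := by
    intro x
    unfold emb
    rw [AddCircle.toCircle_apply_mk, Circle.coe_exp]
    simp only [top1]
    norm_num
  have w1 : HasWind (fun x : ℝ => emb (H 0 ((x : AddCircle (1 : ℝ)), top1)) - emb (H 0 (0, bot1)))
      (2 * Real.pi * Complex.I) := by
    have hb : emb (H 0 (0, bot1)) = 1 := by
      rw [h0]
      simp [emb, bot1]
      norm_num
    have := HasWind.homotopy (Φ := fun z : ℝ × ℝ => 3 * Complex.exp (2 * Real.pi * z.1 * Complex.I)
      - ((projIcc (0 : ℝ) 1 zero_le_one z.2 : ℝ) : ℂ)) (s := 0) (t := 1)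
      (c := 2 * Real.pi * Complex.I) ?_ ?_ ?_ ?_
    · simp only [projIcc_right] at this
      convert this using 3 with x
      · rw [h0]
        exact htopemb x
      · rw [hb]; simp
    · have h1 : Continuous fun z : ℝ × ℝ => ((projIcc (0 : ℝ) 1 zero_le_one z.2 : ℝ) : ℂ) :=
        Complex.continuous_ofReal.comp (continuous_subtype_val.comp
          (continuous_projIcc.comp continuous_snd))
      exact Continuous.sub (by fun_prop) h1
    · intro z hz
      have h1 := congrArg norm (sub_eq_zero.1 hz)
      rw [norm_mul, Complex.norm_exp] at h1
      have h2 := (projIcc (0 : ℝ) 1 zero_le_one z.2).2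
      rw [Complex.norm_real, Real.norm_eq_abs, abs_of_nonneg h2.1] at h1
      simp at h1
      linarith [h2.2]
    · intro t
      simp [Complex.exp_two_pi_mul_I]
    · simpa using w0
  have w2 : HasWind (fun x : ℝ => emb (H 1 ((x : AddCircle (1 : ℝ)), top1)) - emb (H 1 (0, bot1)))
      (2 * Real.pi * Complex.I) := by
    refine HasWind.homotopy (Φ := fun z : ℝ × ℝ =>
      emb (H z.2 ((z.1 : AddCircle (1 : ℝ)), top1)) - emb (H z.2 (0, bot1))) (s := 0) (t := 1)
      ?_ ?_ ?_ w1
    · refine (emb_cont.comp (hH.comp (continuous_snd.prodMk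
        ((hmk.comp continuous_fst).prodMk continuous_const)))).sub
        (emb_cont.comp (hH.comp (continuous_snd.prodMk continuous_const)))
    · intro z hz
      have h1 := hinj _ (emb_inj (sub_eq_zero.1 hz))
      have h2 := congrArg (fun p : Ann => (p.2 : ℝ)) h1
      simp only [top1, bot1] at h2
      norm_num at h2
    · intro t
      simp only [coe_one_eq]
  have hpath : JoinedIn U (H 1 (0, bot1)) (0, top1) := by
    have hconn : IsConnected U := ⟨⟨_, htop⟩, hU⟩
    exact (hUo.isConnected_iff_isPathConnected.1 hconn).joinedIn _ hbot _ htop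
  obtain ⟨γ, hγ⟩ := hpath
  have w3 : HasWind (fun x : ℝ => emb (H 1 ((x : AddCircle (1 : ℝ)), top1)) - emb (0, top1))
      (2 * Real.pi * Complex.I) := by
    have := HasWind.homotopy (Φ := fun z : ℝ × ℝ =>
      emb (H 1 ((z.1 : AddCircle (1 : ℝ)), top1)) - emb (γ.extend z.2)) (s := 0) (t := 1)
      (c := 2 * Real.pi * Complex.I) ?_ ?_ ?_ ?_
    · simpa using this
    · refine (emb_cont.comp (hH.comp (continuous_const.prodMk
        ((hmk.comp continuous_fst).prodMk continuous_const)))).sub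
        (emb_cont.comp (γ.continuous_extend.comp continuous_snd))
    · intro z hz
      have h1 := emb_inj (sub_eq_zero.1 hz)
      apply hdis (z.1 : AddCircle (1 : ℝ))
      rw [h1]
      have : γ.extend z.2 ∈ range γ := by
        rw [← Path.extend_range]
        exact mem_range_self _
      obtain ⟨t, ht⟩ := this
      rw [← ht]
      exact hγ t
    · intro t
      simp only [coe_one_eq]
    · simpa using w2
  have w4 : HasWind (fun x : ℝ => emb (H 1 ((x : AddCircle (1 : ℝ)), top1)) - emb (0, top1)) 0 := by
    have he : emb (0, top1) = 3 := by
      simp [emb, top1]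
      norm_num
    have hcont : Continuous fun x : ℝ => (3 : ℂ) - emb (H 1 ((x : AddCircle (1 : ℝ)), top1)) :=
      continuous_const.sub (emb_cont.comp (hH.comp (continuous_const.prodMk
        (hmk.prodMk continuous_const))))
    have hsl : ∀ x : ℝ, (3 : ℂ) - emb (H 1 ((x : AddCircle (1 : ℝ)), top1)) ∈ Complex.slitPlane := by
      intro x
      left
      set w := emb (H 1 ((x : AddCircle (1 : ℝ)), top1)) with hw
      have hne : w ≠ 3 := by
        intro h
        rw [← he] at h
        exact hdis _ ((emb_inj h) ▸ htop)
      have hn : ‖w‖ ≤ 3 := by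
        rw [hw, emb_norm]
        linarith [(H 1 ((x : AddCircle (1 : ℝ)), top1)).2.2.2]
      have hre : w.re ≤ 3 := (Complex.re_le_norm w).trans hn
      rcases hre.lt_or_eq with h | h
      · simp; linarith
      · exfalso
        apply hne
        have h1 : ‖w‖ ^ 2 ≤ 9 := by nlinarith [norm_nonneg w]
        rw [← Complex.normSq_eq_norm_sq, Complex.normSq_apply, h] at h1
        have : w.im = 0 := by nlinarith
        apply Complex.ext <;> simp [h, this]
    refine ⟨fun x => Complex.log ((3 : ℂ) - emb (H 1 ((x : AddCircle (1 : ℝ)), top1)))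
      + Real.pi * Complex.I, ?_, fun t => ?_, ?_⟩
    · exact (hcont.clog hsl).add continuous_const
    · rw [Complex.exp_add, Complex.exp_log (Complex.slitPlane_ne_zero (hsl t)), he,
        Complex.exp_pi_mul_I]
      ring
    · simp only [coe_one_eq]
      ring
  exact Complex.two_pi_I_ne_zero (w3.unique w4)


/-- `a` and `b` are joined by a (possibly degenerate) arc inside `S`. -/
def ArcJoin (S : Set Strip) (a b : Strip) : Prop :=
  ∃ γ : ℝ → Strip, ∃ d : ℝ, 0 ≤ d ∧ Continuous γ ∧ InjOn γ (Icc 0 d) ∧ γ 0 = a ∧ γ d = b ∧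
    ∀ t ∈ Icc 0 d, γ t ∈ S

lemma ArcJoin.trans {S : Set Strip} {a b c : Strip} (h1 : ArcJoin S a b) (h2 : ArcJoin S b c) :
    ArcJoin S a c := by
  obtain ⟨γ₁, d₁, hd₁, hc₁, hi₁, rfl, hb₁, hS₁⟩ := h1
  obtain ⟨γ₂, d₂, hd₂, hc₂, hi₂, hb₂, rfl, hS₂⟩ := h2
  set K := γ₂ '' Icc 0 d₂ with hK
  have hKc : IsCompact K := isCompact_Icc.image hc₂
  have hcomp : IsCompact (Icc 0 d₁ ∩ γ₁ ⁻¹' K) :=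
    isCompact_Icc.inter_right (hKc.isClosed.preimage hc₁)
  have hne : (Icc 0 d₁ ∩ γ₁ ⁻¹' K).Nonempty :=
    ⟨d₁, ⟨hd₁, le_rfl⟩, ⟨0, ⟨le_rfl, hd₂⟩, by rw [hb₁, hb₂]⟩⟩
  obtain ⟨s, ⟨hs, s', hs', hss⟩, hleast⟩ := hcomp.exists_isLeast hne
  have hbefore : ∀ t ∈ Icc (0 : ℝ) d₁, t < s → ∀ r ∈ Icc (0 : ℝ) d₂, γ₁ t ≠ γ₂ r := by
    intro t ht hts r hr he
    have := hleast ⟨ht, r, hr, he.symm⟩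
    linarith
  refine ⟨fun t => if t ≤ s then γ₁ t else γ₂ (t - s + s'), s + (d₂ - s'), ?_, ?_, ?_, ?_, ?_, ?_⟩
  · linarith [hs.1, hs'.2]
  · refine Continuous.if_le hc₁ (hc₂.comp (by fun_prop)) continuous_id continuous_const ?_
    intro x hx
    rw [hx, ← hss]
    simp
  · intro x hx y hy hxy
    simp only at hxy
    have hx1 : x ≤ s → x ∈ Icc (0 : ℝ) d₁ := fun h => ⟨hx.1, h.trans hs.2⟩
    have hy1 : y ≤ s → y ∈ Icc (0 : ℝ) d₁ := fun h => ⟨hy.1, h.trans hs.2⟩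
    have hx2 : ¬ x ≤ s → x - s + s' ∈ Icc (0 : ℝ) d₂ := fun h =>
      ⟨by linarith [hs'.1], by linarith [hx.2]⟩
    have hy2 : ¬ y ≤ s → y - s + s' ∈ Icc (0 : ℝ) d₂ := fun h =>
      ⟨by linarith [hs'.1], by linarith [hy.2]⟩
    split_ifs at hxy with h1 h2 h2
    · exact hi₁ (hx1 h1) (hy1 h2) hxy
    · exfalso
      rcases h1.lt_or_eq with h | h
      · exact hbefore x (hx1 h1) h _ (hy2 h2) hxy
      · rw [h, ← hss] at hxy
        have := hi₂ hs' (hy2 h2) hxy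
        apply h2; linarith
    · exfalso
      rcases h2.lt_or_eq with h | h
      · exact hbefore y (hy1 h2) h _ (hx2 h1) hxy.symm
      · rw [h, ← hss] at hxy
        have := hi₂ (hx2 h1) hs' hxy
        apply h1; linarith
    · have := hi₂ (hx2 h1) (hy2 h2) hxy
      linarith
  · simp [hs.1]
  · simp only
    split_ifs with h
    · have : d₂ = s' := by linarith [hs'.2]
      rw [this, hss]
      congr 1
      ring
    · congr 1
      ring
  · intro t ht
    simp only
    split_ifs with h
    · exact hS₁ t ⟨ht.1, h.trans hs.2⟩
    · exact hS₂ _ ⟨by linarith [hs'.1], by linarith [ht.2]⟩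

lemma ArcJoin.refl {S : Set Strip} {a : Strip} (ha : a ∈ S) : ArcJoin S a a :=
  ⟨fun _ => a, 0, le_rfl, continuous_const, by intro x hx y hy _; simp at hx hy; rw [hx, hy],
    rfl, rfl, fun _ _ => ha⟩

lemma ArcJoin.mono {S S' : Set Strip} {a b : Strip} (h : ArcJoin S a b) (hS : S ⊆ S') :
    ArcJoin S' a b := by
  obtain ⟨γ₁, d₁, hd₁, hc₁, hi₁, h1, h2, h3⟩ := h
  exact ⟨γ₁, d₁, hd₁, hc₁, hi₁, h1, h2, fun t ht => hS (h3 t ht)⟩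

/-- straight segments -/
lemma ArcJoin.seg {a b c : Strip} {r : ℝ} (ha : a ∈ Metric.ball c r) (hb : b ∈ Metric.ball c r) :
    ArcJoin (Metric.ball c r) a b := by
  by_cases hab : a = b
  · rw [hab]; exact ArcJoin.refl hb
  refine ⟨fun t => (a.1 + t * (b.1 - a.1),
    projIcc (-1 : ℝ) 1 (by norm_num) ((a.2 : ℝ) + t * ((b.2 : ℝ) - a.2))), 1, zero_le_one,
    ?_, ?_, ?_, ?_, ?_⟩
  · exact Continuous.prodMk (by fun_prop) (continuous_projIcc.comp (by fun_prop))
  · intro x hx y hy hxy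
    have hin : ∀ t ∈ Icc (0 : ℝ) 1, ((a.2 : ℝ) + t * ((b.2 : ℝ) - a.2)) ∈ Icc (-1 : ℝ) 1 := by
      intro t ht
      have h1 := a.2.2
      have h2 := b.2.2
      exact ⟨by nlinarith [h1.1, h2.1, ht.1, ht.2], by nlinarith [h1.2, h2.2, ht.1, ht.2]⟩
    simp only [Prod.mk.injEq] at hxy
    obtain ⟨e1, e2⟩ := hxy
    rw [projIcc_of_mem _ (hin x hx), projIcc_of_mem _ (hin y hy), Subtype.mk.injEq] at e2
    by_contra hne
    have hne' : x - y ≠ 0 := sub_ne_zero.2 hne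
    apply hab
    have f1 : (x - y) * (b.1 - a.1) = 0 := by linear_combination e1
    have f2 : (x - y) * ((b.2 : ℝ) - a.2) = 0 := by linear_combination e2
    have g1 := (mul_eq_zero.1 f1).resolve_left hne'
    have g2 := (mul_eq_zero.1 f2).resolve_left hne'
    exact Prod.ext (by linarith) (Subtype.ext (by linarith))
  · simp
  · simp
  · intro t ht
    have hin : ((a.2 : ℝ) + t * ((b.2 : ℝ) - a.2)) ∈ Icc (-1 : ℝ) 1 := by
      have h1 := a.2.2
      have h2 := b.2.2
      exact ⟨by nlinarith [h1.1, h2.1, ht.1, ht.2], by nlinarith [h1.2, h2.2, ht.1, ht.2]⟩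
    simp only [projIcc_of_mem _ hin]
    rw [Metric.mem_ball, Prod.dist_eq, max_lt_iff, Subtype.dist_eq, Real.dist_eq, Real.dist_eq,
      abs_lt, abs_lt] at ha hb ⊢
    simp only
    obtain ⟨⟨a1, a2⟩, a3, a4⟩ := ha
    obtain ⟨⟨b1, b2⟩, b3, b4⟩ := hb
    have key : ∀ p q m : ℝ, -r < p - m → p - m < r → -r < q - m → q - m < r →
        -r < p + t * (q - p) - m ∧ p + t * (q - p) - m < r := by
      intro p q m h1 h2 h3 h4
      rcases eq_or_lt_of_le ht.1 with h | h
      · rw [← h]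
        constructor <;> linarith
      · have e : p + t * (q - p) - m = (1 - t) * (p - m) + t * (q - m) := by ring
        rw [e]
        constructor
        · nlinarith [ht.2, mul_lt_mul_of_pos_left h3 h,
            mul_le_mul_of_nonneg_left h1.le (sub_nonneg.2 ht.2)]
        · nlinarith [ht.2, mul_lt_mul_of_pos_left h4 h,
            mul_le_mul_of_nonneg_left h2.le (sub_nonneg.2 ht.2)]
    exact ⟨key _ _ _ a1 a2 b1 b2, key _ _ _ a3 a4 b3 b4⟩

lemma arc_conn {S : Set Strip} (hS : IsOpen S) {D : Set Strip} (hD : IsPreconnected D)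
    (hDS : D ⊆ S) {a b : Strip} (ha : a ∈ D) (hb : b ∈ D) : ArcJoin S a b := by
  have hball : ∀ z ∈ S, ∃ r > 0, Metric.ball z r ⊆ S := fun z hz => Metric.isOpen_iff.1 hS z hz
  have ho1 : IsOpen {z | z ∈ S ∧ ArcJoin S a z} := by
    rw [Metric.isOpen_iff]
    rintro z ⟨hz, hj⟩
    obtain ⟨r, hr, hsub⟩ := hball z hz
    exact ⟨r, hr, fun w hw => ⟨hsub hw,
      hj.trans ((ArcJoin.seg (Metric.mem_ball_self hr) hw).mono hsub)⟩⟩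
  have ho2 : IsOpen {z | z ∈ S ∧ ¬ ArcJoin S a z} := by
    rw [Metric.isOpen_iff]
    rintro z ⟨hz, hj⟩
    obtain ⟨r, hr, hsub⟩ := hball z hz
    exact ⟨r, hr, fun w hw => ⟨hsub hw, fun hw' => hj
      (hw'.trans ((ArcJoin.seg hw (Metric.mem_ball_self hr)).mono hsub))⟩⟩
  by_contra hcon
  obtain ⟨p, -, hp1, hp2⟩ := hD _ _ ho1 ho2 (by
    intro z hz
    by_cases h : ArcJoin S a z
    · exact Or.inl ⟨hDS hz, h⟩
    · exact Or.inr ⟨hDS hz, h⟩) ⟨a, ha, hDS ha, ArcJoin.refl (hDS ha)⟩ ⟨b, hb, hDS hb, hcon⟩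
  exact hp2.2 hp1.2

lemma ArcJoin.toArc {S : Set Strip} {a p : Strip} (h : ArcJoin (S ∪ {p}) a p) (hap : a ≠ p) :
    ∃ γ : unitInterval → Strip, IsArcTo S γ p ∧ γ 0 = a := by
  obtain ⟨γ, d, hd, hc, hi, h0, h1, hS⟩ := h
  have hdpos : 0 < d := by
    rcases hd.lt_or_eq with h | h
    · exact h
    · exfalso; apply hap; rw [← h0, ← h1, h]
  have hmem : ∀ t : unitInterval, (t : ℝ) * d ∈ Icc 0 d := fun t =>
    ⟨by have := t.2.1; positivity, by nlinarith [t.2.2]⟩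
  refine ⟨fun t => γ (t * d), ⟨?_, ?_, ?_, ?_⟩, ?_⟩
  · exact hc.comp (by fun_prop)
  · intro x y hxy
    have := hi (hmem x) (hmem y) hxy
    exact Subtype.ext (mul_right_cancel₀ hdpos.ne' this)
  · intro t ht
    rcases hS _ (hmem t) with h | h
    · exact h
    · exfalso
      rw [mem_singleton_iff, ← h1] at h
      have := hi (hmem t) ⟨hd, le_rfl⟩ h
      apply ht
      apply Subtype.ext
      have h3 : ((t : ℝ) - 1) * d = 0 := by linarith
      have := (mul_eq_zero.1 h3).resolve_right hdpos.ne'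
      change (t : ℝ) = 1
      linarith
  · simp [h1]
  · simp [h0]


/-- properties of the upper domain -/
structure Setup (U : Set Strip) (η : ℝ) : Prop where
  isOpen : IsOpen U
  pre : IsPreconnected U
  inv : ∀ (k : ℤ) (z : Strip), z ∈ U → shiftPt k z ∈ U
  top : ∀ x : ℝ, ((x, top1) : Strip) ∈ U
  beta : ∀ z : Strip, z.1 = 0 → η < (z.2 : ℝ) → z ∈ U
  x0 : ∀ z : Strip, z.1 = 0 → (z.2 : ℝ) = η → z ∉ U
  hη : η < 1

/-- the union of all translates of `β'` -/
def AllB (η : ℝ) : Set Strip := {z | ∃ j : ℤ, z.1 = j ∧ η < (z.2 : ℝ)}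

/-- complement of all translates -/
def OO (U : Set Strip) (η : ℝ) : Set Strip := U \ AllB η

/-- the components of the complement -/
def comp (U : Set Strip) (η : ℝ) (i : ℤ) : Set Strip :=
  connectedComponentIn (OO U η) ((i : ℝ) + 1 / 2, top1)

/-- right side -/
def Rs (U : Set Strip) (η : ℝ) : Set Strip :=
  {z | (∃ i : ℤ, 0 ≤ i ∧ z ∈ comp U η i) ∨ (∃ j : ℤ, 1 ≤ j ∧ z.1 = j ∧ η < (z.2 : ℝ))}

/-- left side -/
def Ls (U : Set Strip) (η : ℝ) : Set Strip :=
  {z | (∃ i : ℤ, i < 0 ∧ z ∈ comp U η i) ∨ (∃ j : ℤ, j < 0 ∧ z.1 = j ∧ η < (z.2 : ℝ))}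

lemma shift_neg_eq (k : ℤ) (z : Strip) : shiftPt k (shiftPt (-k) z) = z := by
  rw [shift_shift]; simp [shift_zero]

lemma shift_neg_eq' (k : ℤ) (z : Strip) : shiftPt (-k) (shiftPt k z) = z := by
  rw [shift_shift]; simp [shift_zero]

section
variable {U : Set Strip} {η : ℝ}

lemma Setup.betaJ (S : Setup U η) (j : ℤ) (z : Strip) (h1 : z.1 = j) (h2 : η < (z.2 : ℝ)) : z ∈ U := by
  have := S.inv j _ (S.beta (shiftPt (-j) z) (by simp [shiftPt, h1]) h2)
  rwa [shift_neg_eq] at this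

lemma Setup.x0J (S : Setup U η) (j : ℤ) (z : Strip) (h1 : z.1 = j) (h2 : (z.2 : ℝ) = η) : z ∉ U := by
  intro h
  exact S.x0 (shiftPt (-j) z) (by simp [shiftPt, h1]) h2 (S.inv _ _ h)

lemma closed_B : IsClosed {z : Strip | z.1 ∈ range ((↑) : ℤ → ℝ) ∧ η ≤ (z.2 : ℝ)} := by
  refine IsClosed.inter ?_ ?_
  · exact Int.isClosedEmbedding_coe_real.isClosed_range.preimage continuous_fst
  · exact isClosed_le continuous_const (continuous_subtype_val.comp continuous_snd)

lemma Setup.OO_eq (S : Setup U η) : OO U η = U \ {z : Strip | z.1 ∈ range ((↑) : ℤ → ℝ) ∧ η ≤ (z.2 : ℝ)} := by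
  ext z
  constructor
  · rintro ⟨h1, h2⟩
    refine ⟨h1, ?_⟩
    rintro ⟨⟨j, hj⟩, h3⟩
    rcases h3.lt_or_eq with h | h
    · exact h2 ⟨j, hj.symm, h⟩
    · exact S.x0J j z hj.symm h.symm h1
  · rintro ⟨h1, h2⟩
    refine ⟨h1, ?_⟩
    rintro ⟨j, hj, h3⟩
    exact h2 ⟨⟨j, hj.symm⟩, h3.le⟩

lemma Setup.OO_open (S : Setup U η) : IsOpen (OO U η) := by
  rw [S.OO_eq]
  exact S.isOpen.sdiff closed_B

lemma Setup.comp_open (S : Setup U η) (i : ℤ) : IsOpen (comp U η i) := S.OO_open.connectedComponentIn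

lemma comp_sub (i : ℤ) : comp U η i ⊆ OO U η := connectedComponentIn_subset _ _

lemma not_int {x : ℝ} {i j : ℤ} (h1 : (i : ℝ) < x) (h2 : x < i + 1) : x ≠ j := by
  rintro rfl
  have h3 : i < j := by exact_mod_cast h1
  have h4 : j < i + 1 := by exact_mod_cast h2
  omega

lemma Setup.top_comp (S : Setup U η) (i : ℤ) (x : ℝ) (h1 : (i : ℝ) < x) (h2 : x < i + 1) :
    ((x, top1) : Strip) ∈ comp U η i := by
  have hp : IsPreconnected ((fun x : ℝ => ((x, top1) : Strip)) '' Ioo (i : ℝ) (i + 1)) :=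
    isPreconnected_Ioo.image _ (Continuous.continuousOn (by fun_prop))
  have := hp.subset_connectedComponentIn (F := OO U η) (x := (((i : ℝ) + 1 / 2, top1) : Strip))
    ⟨(i : ℝ) + 1 / 2, ⟨by linarith, by linarith⟩, rfl⟩ (by
      rintro _ ⟨y, hy, rfl⟩
      refine ⟨S.top y, ?_⟩
      rintro ⟨j, hj, -⟩
      exact not_int hy.1 hy.2 hj)
  exact this ⟨x, ⟨h1, h2⟩, rfl⟩

lemma Setup.center_mem (S : Setup U η) (i : ℤ) : (((i : ℝ) + 1 / 2, top1) : Strip) ∈ comp U η i :=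
  S.top_comp i _ (by linarith) (by linarith)

lemma Setup.shift_comp (S : Setup U η) (k i : ℤ) (z : Strip) (hz : z ∈ comp U η i) :
    shiftPt k z ∈ comp U η (i + k) := by
  have hp : IsPreconnected (shiftPt k '' comp U η i) :=
    isPreconnected_connectedComponentIn.image _ (shift_cont k).continuousOn
  have := hp.subset_connectedComponentIn (F := OO U η)
    (x := ((((i + k : ℤ) : ℝ) + 1 / 2, top1) : Strip))
    ⟨_, S.center_mem i, Prod.ext (by simp only [shiftPt]; push_cast; ring) rfl⟩ (by
      rintro _ ⟨y, hy, rfl⟩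
      have hy' := comp_sub i hy
      refine ⟨S.inv _ _ hy'.1, ?_⟩
      rintro ⟨j, hj, h3⟩
      refine hy'.2 ⟨j - k, ?_, h3⟩
      simp only [shiftPt] at hj
      push_cast
      linarith)
  exact this ⟨z, hz, rfl⟩

lemma Setup.tube (S : Setup U η) (j : ℤ) (y : II) (hy : η < (y : ℝ)) :
    ∃ ε : ℝ, 0 < ε ∧ ε ≤ 1 ∧ η ≤ (y : ℝ) - ε ∧
      ∀ z : Strip, |z.1 - j| < ε → (y : ℝ) - ε < z.2 → z ∈ U := by
  have hK : IsCompact (({(j : ℝ)} : Set ℝ) ×ˢ (Ici y : Set II)) :=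
    isCompact_singleton.prod isClosed_Ici.isCompact
  obtain ⟨δ, hδ, hsub⟩ := hK.exists_thickening_subset_open S.isOpen (by
    rintro z ⟨h1, h2⟩
    exact S.betaJ j z h1 (lt_of_lt_of_le hy h2))
  refine ⟨min (min δ 1) ((y : ℝ) - η), ?_, ?_, ?_, ?_⟩
  · exact lt_min (lt_min hδ one_pos) (by linarith)
  · exact (min_le_left _ _).trans (min_le_right _ _)
  · linarith [min_le_right (min δ 1) ((y : ℝ) - η)]
  · intro z h1 h2
    have hle : min (min δ 1) ((y : ℝ) - η) ≤ δ := (min_le_left _ _).trans (min_le_left _ _)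
    apply hsub
    rw [Metric.mem_thickening_iff]
    refine ⟨((j : ℝ), max z.2 y), ⟨rfl, Set.mem_Ici.2 (le_max_right z.2 y)⟩, ?_⟩
    rw [Prod.dist_eq, max_lt_iff]
    constructor
    · rw [Real.dist_eq]; linarith
    · simp only
      rcases le_total z.2 y with h | h
      · rw [max_eq_right h, Subtype.dist_eq, Real.dist_eq, abs_lt]
        have : (z.2 : ℝ) ≤ y := h
        constructor <;> linarith
      · rw [max_eq_left h, dist_self]
        exact hδ

lemma box_preconn (a b c : ℝ) :
    IsPreconnected {z : Strip | z.1 ∈ Ioo a b ∧ c < (z.2 : ℝ)} := by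
  have h : IsPreconnected {y : II | c < (y : ℝ)} := by
    have h1 : IsPreconnected (Icc (-1 : ℝ) 1 ∩ Ioi c) :=
      (ordConnected_Icc.inter ordConnected_Ioi).isPreconnected
    have h2 := h1.image (projIcc (-1 : ℝ) 1 (by norm_num)) continuous_projIcc.continuousOn
    convert h2 using 1
    ext y
    constructor
    · intro hy
      exact ⟨y, ⟨y.2, hy⟩, projIcc_val _ y⟩
    · rintro ⟨t, ⟨ht, htc⟩, rfl⟩
      rw [projIcc_of_mem _ ht]
      exact htc
  exact (isPreconnected_Ioo (a := a) (b := b)).prod h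

lemma Setup.side (S : Setup U η) (j : ℤ) (z : Strip) (h1 : z.1 = j) (h2 : η < (z.2 : ℝ)) :
    ∃ W ∈ 𝓝 z, ∀ w ∈ W, (w.1 = j ∧ η < (w.2 : ℝ)) ∨ w ∈ comp U η j ∨ w ∈ comp U η (j - 1) := by
  obtain ⟨ε, he0, he1, he2, hU⟩ := S.tube j z.2 h2
  refine ⟨{w | |w.1 - j| < ε ∧ (z.2 : ℝ) - ε < w.2}, ?_, ?_⟩
  · refine IsOpen.mem_nhds ?_ ?_
    · refine IsOpen.inter ?_ ?_
      · exact isOpen_lt (continuous_abs.comp (continuous_fst.sub continuous_const)) continuous_const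
      · exact isOpen_lt continuous_const (continuous_subtype_val.comp continuous_snd)
    · exact ⟨by simpa [h1] using he0, by linarith⟩
  · rintro w ⟨hw1, hw2⟩
    rw [abs_lt] at hw1
    rcases lt_trichotomy w.1 j with h | h | h
    · right; right
      have hp := (box_preconn ((j : ℝ) - ε) j ((z.2 : ℝ) - ε))
      have hcm : (((j : ℝ) - ε / 2, top1) : Strip) ∈ comp U η (j - 1) :=
        S.top_comp _ _ (by push_cast; linarith) (by push_cast; linarith)
      have := hp.subset_connectedComponentIn (F := OO U η)
        (x := (((j : ℝ) - ε / 2, top1) : Strip)) ⟨⟨by linarith, by linarith⟩, by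
          have := z.2.2.2
          simp only [top1]; linarith⟩ (by
          rintro v ⟨⟨hv1, hv2⟩, hv3⟩
          refine ⟨hU v (abs_lt.2 ⟨by linarith, by linarith⟩) hv3, ?_⟩
          rintro ⟨i, hi, -⟩
          exact not_int (i := j - 1) (by push_cast; linarith) (by push_cast; linarith) hi)
      rw [← connectedComponentIn_eq hcm] at this
      exact this ⟨⟨by linarith, h⟩, hw2⟩
    · left
      exact ⟨h, by linarith⟩
    · right; left
      have hp := (box_preconn (j : ℝ) (j + ε) ((z.2 : ℝ) - ε))
      have hcm : (((j : ℝ) + ε / 2, top1) : Strip) ∈ comp U η j :=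
        S.top_comp _ _ (by linarith) (by linarith)
      have := hp.subset_connectedComponentIn (F := OO U η)
        (x := (((j : ℝ) + ε / 2, top1) : Strip)) ⟨⟨by linarith, by linarith⟩, by
          have := z.2.2.2
          simp only [top1]; linarith⟩ (by
          rintro v ⟨⟨hv1, hv2⟩, hv3⟩
          refine ⟨hU v (abs_lt.2 ⟨by linarith, by linarith⟩) hv3, ?_⟩
          rintro ⟨i, hi, -⟩
          exact not_int (i := j) (by linarith) (by linarith) hi)
      rw [← connectedComponentIn_eq hcm] at this
      exact this ⟨⟨h, by linarith⟩, hw2⟩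

lemma Setup.cover (S : Setup U η) (z : Strip) (hz : z ∈ U) :
    (∃ i : ℤ, z ∈ comp U η i) ∨ (∃ j : ℤ, z.1 = j ∧ η < (z.2 : ℝ)) := by
  set A : Set Strip := {z | (∃ i : ℤ, z ∈ comp U η i) ∨ (∃ j : ℤ, z.1 = j ∧ η < (z.2 : ℝ))}
    with hA
  have hAo : IsOpen A := by
    rw [isOpen_iff_mem_nhds]
    rintro z (⟨i, hi⟩ | ⟨j, hj, h2⟩)
    · exact mem_of_superset ((S.comp_open i).mem_nhds hi) fun w hw => Or.inl ⟨i, hw⟩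
    · obtain ⟨W, hW, h⟩ := S.side j z hj h2
      refine mem_of_superset hW fun w hw => ?_
      rcases h w hw with h | h | h
      · exact Or.inr ⟨j, h⟩
      · exact Or.inl ⟨_, h⟩
      · exact Or.inl ⟨_, h⟩
  have hBo : IsOpen (U \ A) := by
    rw [isOpen_iff_mem_nhds]
    rintro z ⟨hz, hzA⟩
    have hzO : z ∈ OO U η := ⟨hz, fun h => hzA (Or.inr h)⟩
    have ho : IsOpen (connectedComponentIn (OO U η) z) := S.OO_open.connectedComponentIn
    refine mem_of_superset (ho.mem_nhds (mem_connectedComponentIn hzO)) ?_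
    intro w hw
    have hwO := connectedComponentIn_subset _ _ hw
    refine ⟨hwO.1, ?_⟩
    rintro (⟨i, hi⟩ | h)
    · apply hzA
      left
      refine ⟨i, ?_⟩
      have h1 := connectedComponentIn_eq hw
      have h2 := connectedComponentIn_eq hi
      unfold comp
      rw [h2, ← h1]
      exact mem_connectedComponentIn hzO
    · exact hwO.2 h
  by_contra hcon
  obtain ⟨p, -, hp1, hp2⟩ := S.pre A (U \ A) hAo hBo (by
    intro z hz
    by_cases h : z ∈ A
    · exact Or.inl h
    · exact Or.inr ⟨hz, h⟩) ⟨_, S.top _, Or.inl ⟨0, S.center_mem 0⟩⟩ ⟨z, hz, hz, hcon⟩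
  exact hp2.2 hp1

lemma Setup.comp_bound (S : Setup U η) {m : ℝ} (hm : m ∈ lowerBounds (Prod.fst '' Vset U η))
    (i : ℤ) (z : Strip) (hz : z ∈ comp U η i) : m + i ≤ z.1 := by
  have h0 := S.shift_comp (-i) i z hz
  rw [add_neg_cancel] at h0
  have hV : shiftPt (-i) z ∈ Vset U η := by
    refine ⟨(comp_sub _ h0).1, subset_closure ?_⟩
    have hts : topSeg = ((((0 : ℤ) : ℝ) + 1 / 2, top1) : Strip) := by
      unfold topSeg top1
      simp
    rw [hts]
    refine connectedComponentIn_mono _ ?_ h0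
    rintro w ⟨hw1, hw2⟩
    refine ⟨hw1, ?_⟩
    rintro (⟨h1, h2⟩ | ⟨v, ⟨h1, h2⟩, rfl⟩)
    · exact hw2 ⟨0, by simpa using h1, h2⟩
    · exact hw2 ⟨1, by simp [shiftPt, h1], h2⟩
  have := hm ⟨_, hV, rfl⟩
  simp only [shiftPt] at this
  push_cast at this
  linarith

lemma Setup.comp_disj (S : Setup U η) {m : ℝ} (hm : m ∈ lowerBounds (Prod.fst '' Vset U η))
    {i j : ℤ} (hij : i < j) {z : Strip} (hi : z ∈ comp U η i) (hj : z ∈ comp U η j) : False := by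
  have heq : comp U η i = comp U η j := by
    unfold comp at hi hj ⊢
    rw [connectedComponentIn_eq hi, connectedComponentIn_eq hj]
  have step : ∀ k : ℕ, z ∈ comp U η (i + k * (j - i)) := by
    intro k
    induction k with
    | zero => simpa using hi
    | succ k ih =>
      have h1 := S.shift_comp (-(k * (j - i))) _ z ih
      rw [show i + k * (j - i) + -(k * (j - i)) = i by ring, heq] at h1
      have h2 := S.shift_comp (k * (j - i)) _ _ h1
      rw [shift_neg_eq] at h2
      convert h2 using 1
      push_cast
      ring_nf
  obtain ⟨k, hk⟩ := exists_nat_gt (z.1 - m - i)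
  have h1 := S.comp_bound hm _ z (step k)
  have h2 : (1 : ℝ) ≤ (j : ℝ) - i := by
    have : i + 1 ≤ j := hij
    have : (i : ℝ) + 1 ≤ j := by exact_mod_cast this
    linarith
  push_cast at h1
  have h3 : (0 : ℝ) ≤ k := Nat.cast_nonneg k
  nlinarith

lemma Setup.Rs_open (S : Setup U η) : IsOpen (Rs U η) := by
  rw [isOpen_iff_mem_nhds]
  rintro z (⟨i, hi0, hi⟩ | ⟨j, hj0, hj, h2⟩)
  · exact mem_of_superset ((S.comp_open i).mem_nhds hi) fun w hw => Or.inl ⟨i, hi0, hw⟩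
  · obtain ⟨W, hW, h⟩ := S.side j z hj h2
    refine mem_of_superset hW fun w hw => ?_
    rcases h w hw with h | h | h
    · exact Or.inr ⟨j, hj0, h⟩
    · exact Or.inl ⟨_, by omega, h⟩
    · exact Or.inl ⟨_, by omega, h⟩

lemma Setup.Ls_open (S : Setup U η) : IsOpen (Ls U η) := by
  rw [isOpen_iff_mem_nhds]
  rintro z (⟨i, hi0, hi⟩ | ⟨j, hj0, hj, h2⟩)
  · exact mem_of_superset ((S.comp_open i).mem_nhds hi) fun w hw => Or.inl ⟨i, hi0, hw⟩
  · obtain ⟨W, hW, h⟩ := S.side j z hj h2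
    refine mem_of_superset hW fun w hw => ?_
    rcases h w hw with h | h | h
    · exact Or.inr ⟨j, hj0, h⟩
    · exact Or.inl ⟨_, by omega, h⟩
    · exact Or.inl ⟨_, by omega, h⟩

lemma Setup.disj (S : Setup U η) {m : ℝ} (hm : m ∈ lowerBounds (Prod.fst '' Vset U η)) :
    Disjoint (Ls U η) (Rs U η) := by
  rw [Set.disjoint_left]
  rintro z (⟨i, hi0, hi⟩ | ⟨j, hj0, hj, h2⟩) (⟨i', hi0', hi'⟩ | ⟨j', hj0', hj', h2'⟩)
  · exact S.comp_disj hm (by omega : i < i') hi hi'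
  · exact (comp_sub _ hi).2 ⟨j', hj', h2'⟩
  · exact (comp_sub _ hi').2 ⟨j, hj, h2⟩
  · rw [hj] at hj'
    have : j = j' := by exact_mod_cast hj'
    omega

lemma Setup.cover3 (S : Setup U η) (z : Strip) (hz : z ∈ U) :
    z ∈ Ls U η ∨ z ∈ Rs U η ∨ (z.1 = 0 ∧ η < (z.2 : ℝ)) := by
  rcases S.cover z hz with ⟨i, hi⟩ | ⟨j, hj, h2⟩
  · rcases lt_or_ge i 0 with h | h
    · exact Or.inl (Or.inl ⟨i, h, hi⟩)
    · exact Or.inr (Or.inl (Or.inl ⟨i, h, hi⟩))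
  · rcases lt_trichotomy j 0 with h | h | h
    · exact Or.inl (Or.inr ⟨j, h, hj, h2⟩)
    · exact Or.inr (Or.inr ⟨by simpa [h] using hj, h2⟩)
    · exact Or.inr (Or.inl (Or.inr ⟨j, h, hj, h2⟩))

lemma Setup.Rs_bound (S : Setup U η) {m : ℝ} (hm : m ∈ lowerBounds (Prod.fst '' Vset U η)) (hm0 : m ≤ 0)
    (z : Strip) (hz : z ∈ Rs U η) : m ≤ z.1 := by
  rcases hz with ⟨i, hi0, hi⟩ | ⟨j, hj0, hj, h2⟩
  · have := S.comp_bound hm i z hi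
    have h : (0 : ℝ) ≤ i := by exact_mod_cast hi0
    linarith
  · have h : (1 : ℝ) ≤ j := by exact_mod_cast hj0
    linarith

lemma Setup.eventually_Rs (S : Setup U η) (z : Strip) (hz : z ∈ U) :
    ∃ m₀ : ℤ, ∀ m ≥ m₀, shiftPt m z ∈ Rs U η := by
  rcases S.cover z hz with ⟨i, hi⟩ | ⟨j, hj, h2⟩
  · exact ⟨-i, fun m hm => Or.inl ⟨i + m, by omega, S.shift_comp m i z hi⟩⟩
  · exact ⟨1 - j, fun m hm => Or.inr ⟨j + m, by omega, by simp [shiftPt, hj], h2⟩⟩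

end


lemma neg_one_le_one : (-1 : ℝ) ≤ 1 := by norm_num

/-- clamp to the fiber -/
noncomputable def clamp (t : ℝ) : II := projIcc (-1 : ℝ) 1 neg_one_le_one t

lemma clamp_cont : Continuous clamp := continuous_projIcc (h := neg_one_le_one)

lemma clamp_val {t : ℝ} (h1 : -1 ≤ t) (h2 : t ≤ 1) : (clamp t : ℝ) = t := by
  unfold clamp
  rw [projIcc_of_mem _ ⟨h1, h2⟩]

/-- The vertical arc `β + j`. -/
noncomputable def bArc (η : ℝ) (j : ℤ) (t : unitInterval) : Strip := ((j : ℝ), clamp (1 - t * (1 - η)))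

lemma bArc_val {η : ℝ} (h1 : -1 ≤ η) (h2 : η < 1) (j : ℤ) (t : unitInterval) :
    ((bArc η j t).2 : ℝ) = 1 - t * (1 - η) := by
  have := t.2.1
  have := t.2.2
  exact clamp_val (by nlinarith) (by nlinarith)

lemma bArc_ge {η : ℝ} (h1 : -1 ≤ η) (h2 : η < 1) (j : ℤ) (t : unitInterval) :
    η ≤ ((bArc η j t).2 : ℝ) := by
  rw [bArc_val h1 h2]
  have := t.2.1
  have := t.2.2
  nlinarith

lemma bArc_zero (η : ℝ) (j : ℤ) : bArc η j 0 = ((j : ℝ), top1) := by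
  refine Prod.ext rfl (Subtype.ext ?_)
  simp only [bArc, top1]
  rw [clamp_val] <;> simp

lemma shift_inj (k : ℤ) : Function.Injective (shiftPt k) := by
  intro a b h
  rw [← shift_neg_eq' k a, h, shift_neg_eq']

section
variable {U : Set Strip} {η : ℝ}

lemma Setup.bArc_arc (S : Setup U η) {x₀ : Strip} (hx1 : x₀.1 = 0) (hx2 : (x₀.2 : ℝ) = η) (j : ℤ) :
    IsArcTo U (bArc η j) (shiftPt j x₀) := by
  have hη1 : -1 ≤ η := hx2 ▸ x₀.2.2.1
  have hη2 := S.hη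
  refine ⟨?_, ?_, ?_, ?_⟩
  · exact continuous_const.prodMk (clamp_cont.comp (by fun_prop))
  · intro s t h
    have h3 : ((bArc η j s).2 : ℝ) = (bArc η j t).2 := by rw [h]
    rw [bArc_val hη1 hη2, bArc_val hη1 hη2] at h3
    apply Subtype.ext
    have h4 : ((s : ℝ) - t) * (1 - η) = 0 := by linarith
    rcases mul_eq_zero.1 h4 with h | h <;> linarith
  · intro t ht
    refine S.betaJ j _ rfl ?_
    rw [bArc_val hη1 hη2]
    have : (t : ℝ) < 1 := lt_of_le_of_ne t.2.2 (fun h => ht (Subtype.ext h))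
    nlinarith
  · refine Prod.ext (by simp [bArc, shiftPt, hx1]) (Subtype.ext ?_)
    rw [bArc_val hη1 hη2]
    simp [shiftPt, hx2]

lemma Setup.acc (S : Setup U η) {x₀ : Strip} (hx1 : x₀.1 = 0) (hx2 : (x₀.2 : ℝ) = η) (Φ : Strip ≃ₜ Strip)
    (hΦU : ∀ z, Φ z ∈ U ↔ z ∈ U) (hp : 0 ≤ (Φ x₀).1) :
    ∃ k : ℤ, AccIdxB 1 U (Φ x₀) x₀ k ∧
      (k < 0 → ∃ ε > 0, ∀ z : Strip, z.1 = 0 → η < (z.2 : ℝ) → (z.2 : ℝ) < η + ε →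
        Φ z ∈ Ls U η) := by
  have hη1 : -1 ≤ η := hx2 ▸ x₀.2.2.1
  have hη2 := S.hη
  have hpU : Φ x₀ ∉ U := fun h => S.x0 x₀ hx1 hx2 ((hΦU _).1 h)
  have htop : ((top1 : II) : ℝ) = 1 := rfl
  by_cases hc : ∃ j : ℤ, shiftPt j x₀ = Φ x₀
  · obtain ⟨j, hj⟩ := hc
    refine ⟨j, ⟨Or.inl hj, ?_⟩, ?_⟩
    · rw [← hj]
      refine ⟨bArc η j, bArc η (j + 1), S.bArc_arc hx1 hx2 j, S.bArc_arc hx1 hx2 (j + 1), ?_, ?_,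
        ?_, ?_⟩
      · rw [bArc_zero]; rfl
      · rw [bArc_zero]; rfl
      · rw [Set.disjoint_left]
        rintro _ ⟨s, rfl⟩ ⟨t, ht⟩
        have := congrArg Prod.fst ht
        simp [bArc] at this
      · rw [bArc_zero, bArc_zero]; simp
    · intro hj0
      rw [← hj] at hp
      simp only [shiftPt, hx1, zero_add] at hp
      have : 0 ≤ j := by exact_mod_cast hp
      omega
  push Not at hc
  -- the generic case
  set B : Set Strip := {z : Strip | z.1 ∈ range ((↑) : ℤ → ℝ) ∧ η ≤ (z.2 : ℝ)} with hB
  have hBcl : IsClosed B := closed_B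
  have hpB : Φ x₀ ∉ B := by
    rintro ⟨⟨j, hj⟩, h⟩
    rcases h.lt_or_eq with h | h
    · exact hpU (S.betaJ j _ hj.symm h)
    · refine hc j (Prod.ext ?_ (Subtype.ext ?_))
      · simp [shiftPt, hx1, hj]
      · simp [shiftPt, hx2, h]
  have hnb : Φ ⁻¹' Bᶜ ∈ 𝓝 x₀ := (hBcl.isOpen_compl.preimage Φ.continuous).mem_nhds hpB
  obtain ⟨ε, he, hball⟩ := Metric.mem_nhds_iff.1 hnb
  set tail : Set Strip := {z : Strip | z.1 = 0 ∧ η < (z.2 : ℝ) ∧ (z.2 : ℝ) < η + ε} with htail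
  have htO : ∀ z ∈ tail, Φ z ∈ OO U η := by
    rintro z ⟨h1, h2, h3⟩
    rw [S.OO_eq]
    refine ⟨(hΦU z).2 (S.beta z h1 h2), ?_⟩
    apply hball
    rw [Metric.mem_ball, Prod.dist_eq, max_lt_iff, h1, hx1, Subtype.dist_eq, hx2, dist_self,
      Real.dist_eq, abs_lt]
    refine ⟨he, by linarith, by linarith⟩
  have htp : IsPreconnected tail := by
    have h1 : IsPreconnected (Icc (-1 : ℝ) 1 ∩ Ioo η (η + ε)) :=
      (ordConnected_Icc.inter ordConnected_Ioo).isPreconnected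
    have h2 := h1.image (fun t => ((0, clamp t) : Strip))
      (continuous_const.prodMk clamp_cont).continuousOn
    convert h2 using 1
    ext y
    constructor
    · rintro ⟨hy1, hy2⟩
      exact ⟨y.2, ⟨y.2.2, hy2⟩, Prod.ext hy1.symm (projIcc_val neg_one_le_one y.2)⟩
    · rintro ⟨t, ⟨ht, htc⟩, rfl⟩
      refine ⟨rfl, ?_⟩
      simp only
      rw [clamp_val ht.1 ht.2]
      exact htc
  -- a base point of the tail
  set e : ℝ := min (ε / 2) (1 - η) with hedef
  have he0 : 0 < e := lt_min (by linarith) (by linarith)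
  have he1 : e < ε := lt_of_le_of_lt (min_le_left _ _) (by linarith)
  have he2 : η + e ≤ 1 := by linarith [min_le_right (ε / 2) (1 - η)]
  set z1 : Strip := (0, clamp (η + e)) with hz1
  have hz1v : (z1.2 : ℝ) = η + e := clamp_val (by linarith) he2
  have hz1t : z1 ∈ tail := ⟨rfl, by linarith, by linarith⟩
  obtain ⟨i, hi⟩ : ∃ i : ℤ, Φ z1 ∈ comp U η i := by
    rcases S.cover _ (htO z1 hz1t).1 with h | h
    · exact h
    · exact absurd h (htO z1 hz1t).2
  have htc : ∀ z ∈ tail, Φ z ∈ comp U η i := by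
    have h1 : IsPreconnected (Φ '' tail) := htp.image _ Φ.continuous.continuousOn
    have h2 := h1.subset_connectedComponentIn (F := OO U η) ⟨z1, hz1t, rfl⟩ (by
      rintro _ ⟨z, hz, rfl⟩; exact htO z hz)
    unfold comp at hi ⊢
    rw [connectedComponentIn_eq hi]
    exact fun z hz => h2 ⟨z, hz, rfl⟩
  have hA1 : ArcJoin (OO U η ∪ {Φ x₀}) ((i : ℝ) + 1 / 2, top1) (Φ z1) :=
    (arc_conn S.OO_open (D := comp U η i) isPreconnected_connectedComponentIn (comp_sub i)
      (S.center_mem i) hi).mono subset_union_left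
  have hcv : ∀ t ∈ Icc (0 : ℝ) e, (clamp (η + e - t) : ℝ) = η + e - t := fun t ht =>
    clamp_val (by linarith [ht.2]) (by linarith [ht.1])
  have hA2 : ArcJoin (OO U η ∪ {Φ x₀}) (Φ z1) (Φ x₀) := by
    refine ⟨fun t => Φ (0, clamp (η + e - t)), e, he0.le, ?_, ?_, ?_, ?_, ?_⟩
    · exact Φ.continuous.comp (continuous_const.prodMk (clamp_cont.comp (by fun_prop)))
    · intro s hs t ht h
      have h2 := congrArg (fun z : Strip => (z.2 : ℝ)) (Φ.injective h)
      simp only at h2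
      rw [hcv s hs, hcv t ht] at h2
      linarith
    · simp [hz1]
    · simp only
      congr 1
      refine Prod.ext hx1.symm (Subtype.ext ?_)
      simp only
      rw [hcv e ⟨he0.le, le_rfl⟩, hx2]
      ring
    · intro t ht
      rcases ht.2.lt_or_eq with h | h
      · left
        apply htO
        refine ⟨rfl, ?_, ?_⟩
        · simp only
          rw [hcv t ht]; linarith
        · simp only
          rw [hcv t ht]; linarith [ht.1]
      · right
        simp only [mem_singleton_iff]
        congr 1
        refine Prod.ext hx1.symm (Subtype.ext ?_)
        simp only
        rw [hcv t ht, hx2, h]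
        ring
  have hne : (((i : ℝ) + 1 / 2, top1) : Strip) ≠ Φ x₀ := fun h => hpU (h ▸ S.top _)
  obtain ⟨γ, hγ, hγ0⟩ := (hA1.trans hA2).toArc hne
  have hγU : IsArcTo U γ (Φ x₀) := ⟨hγ.1, hγ.2.1, fun t ht => (hγ.2.2.1 t ht).1, hγ.2.2.2⟩
  have hγB : ∀ t, γ t ∉ B := by
    intro t
    by_cases ht : t = 1
    · rw [ht, hγ.2.2.2]; exact hpB
    · have := hγ.2.2.1 t ht
      rw [S.OO_eq] at this
      exact this.2
  have hbB : ∀ j t, bArc η j t ∈ B := fun j t => ⟨⟨j, rfl⟩, bArc_ge hη1 hη2 j t⟩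
  refine ⟨i, ⟨Or.inr ⟨bArc η i, γ, S.bArc_arc hx1 hx2 i, hγU, ?_, ?_, ?_, ?_⟩,
    ⟨γ, bArc η (i + 1), hγU, S.bArc_arc hx1 hx2 (i + 1), ?_, ?_, ?_, ?_⟩⟩, ?_⟩
  · rw [bArc_zero]; rfl
  · rw [hγ0]; rfl
  · rw [Set.disjoint_left]
    rintro _ ⟨s, rfl⟩ ⟨t, ht⟩
    exact hγB t (ht ▸ hbB i s)
  · rw [bArc_zero, hγ0]
    simp only
    linarith
  · rw [hγ0]; rfl
  · rw [bArc_zero]; rfl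
  · rw [Set.disjoint_left]
    rintro _ ⟨s, rfl⟩ ⟨t, ht⟩
    exact hγB s (ht ▸ hbB (i + 1) t)
  · rw [bArc_zero, hγ0]
    simp only
    push_cast
    linarith
  · intro hi0
    exact ⟨ε, he, fun z h1 h2 h3 => Or.inl ⟨i, hi0, htc z ⟨h1, h2, h3⟩⟩⟩

end


instance instPreII : PreconnectedSpace II := Subtype.preconnectedSpace isPreconnected_Icc

lemma sub_comp {α : Type*} [TopologicalSpace α] {O D : Set α} {x z : α} (hD : IsPreconnected D)
    (hDO : D ⊆ O) (hz : z ∈ D) (hzc : z ∈ connectedComponentIn O x) :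
    D ⊆ connectedComponentIn O x := by
  rw [connectedComponentIn_eq hzc]
  exact hD.subset_connectedComponentIn hz hDO

section
variable {U : Set Strip} {η : ℝ}

lemma Setup.eventually_Ls (S : Setup U η) (z : Strip) (hz : z ∈ U) :
    ∃ m : ℤ, shiftPt m z ∈ Ls U η := by
  rcases S.cover z hz with ⟨i, hi⟩ | ⟨j, hj, h2⟩
  · exact ⟨-i - 1, Or.inl ⟨i + (-i - 1), by omega, S.shift_comp _ i z hi⟩⟩
  · exact ⟨-j - 1, Or.inr ⟨j + (-j - 1), by omega, by simp [shiftPt, hj], h2⟩⟩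

lemma Setup.contra (S : Setup U η) {m : ℝ} (hm : m ∈ lowerBounds (Prod.fst '' Vset U η)) (hm0 : m ≤ 0)
    {x₀ : Strip} (hx1 : x₀.1 = 0) (hx2 : (x₀.2 : ℝ) = η) (Φ : Strip ≃ₜ Strip)
    (hΦU : ∀ z, Φ z ∈ U ↔ z ∈ U)
    (hΦs : ∀ (k : ℤ) (z : Strip), Φ (shiftPt k z) = shiftPt k (Φ z))
    (ht : ∃ ε > 0, ∀ z : Strip, z.1 = 0 → η < (z.2 : ℝ) → (z.2 : ℝ) < η + ε → Φ z ∈ Ls U η)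
    (hq : (Φ.symm x₀).1 < m)
    (hN : ∀ C : Set Strip, IsCompact C → C ⊆ U → ∃ N : Set Strip, IsOpen N ∧ IsPreconnected N ∧
      N ∪ U = univ ∧ (∀ z ∈ N, z ∉ C) ∧ (∀ (k : ℤ) (z : Strip), z ∈ N → shiftPt k z ∈ N)) :
    False := by
  obtain ⟨ε1, he1, htail⟩ := ht
  have hopen : IsOpen {w : Strip | (Φ.symm w).1 < m} :=
    isOpen_lt (continuous_fst.comp Φ.symm.continuous) continuous_const
  obtain ⟨ε2, he2, hball⟩ := Metric.mem_nhds_iff.1 (hopen.mem_nhds hq)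
  set ε := min ε1 ε2 with hε
  have hε0 : 0 < ε := lt_min he1 he2
  set C0 : Set Strip := {z : Strip | z.1 = 0 ∧ η + ε ≤ (z.2 : ℝ)} with hC0
  have hC0c : IsCompact C0 := by
    have h1 : IsCompact {y : II | η + ε ≤ (y : ℝ)} :=
      (isClosed_le continuous_const continuous_subtype_val).isCompact
    exact (isCompact_singleton (x := (0 : ℝ))).prod h1
  have hC0U : C0 ⊆ U := fun z hz => S.beta z hz.1 (by linarith [hz.2])
  have hCc : IsCompact (C0 ∪ Φ.symm '' C0) := hC0c.union (hC0c.image Φ.symm.continuous)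
  obtain ⟨N, hNo, hNp, hNU, hNC, hNs⟩ := hN _ hCc (by
    apply union_subset hC0U
    rintro _ ⟨z, hz, rfl⟩
    rw [← hΦU, Φ.apply_symm_apply]
    exact hC0U hz)
  have hx0N : x₀ ∈ N := by
    have : x₀ ∈ N ∪ U := by rw [hNU]; trivial
    rcases this with h | h
    · exact h
    · exact absurd h (S.x0 x₀ hx1 hx2)
  obtain ⟨z, hzN, hzU⟩ := nonempty_inter hNo S.isOpen hNU ⟨x₀, hx0N⟩ ⟨_, S.top 0⟩
  have hdis := Set.disjoint_left.1 (S.disj hm)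
  refine inter_preconn N U hNo S.isOpen hNp S.pre hNU
    (N ∩ U ∩ (Rs U η ∩ Φ ⁻¹' (Rs U η))) (N ∩ U ∩ (Ls U η ∪ Φ ⁻¹' (Ls U η))) ?_ ?_ ?_ ?_ ?_ ?_
  · exact (hNo.inter S.isOpen).inter (S.Rs_open.inter (S.Rs_open.preimage Φ.continuous))
  · exact (hNo.inter S.isOpen).inter (S.Ls_open.union (S.Ls_open.preimage Φ.continuous))
  · rw [Set.disjoint_left]
    rintro w ⟨-, hw1, hw2⟩ ⟨-, hw | hw⟩
    · exact hdis hw hw1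
    · exact hdis hw hw2
  · apply subset_antisymm
    · rintro w ⟨hwN, hwU⟩
      rcases S.cover3 w hwU with h | h | ⟨h1, h2⟩
      · exact Or.inr ⟨⟨hwN, hwU⟩, Or.inl h⟩
      · rcases S.cover3 (Φ w) ((hΦU w).2 hwU) with h' | h' | ⟨h1, h2⟩
        · exact Or.inr ⟨⟨hwN, hwU⟩, Or.inr h'⟩
        · exact Or.inl ⟨⟨hwN, hwU⟩, h, h'⟩
        · exfalso
          have hlt : ((Φ w).2 : ℝ) < η + ε := by
            by_contra hcon
            push Not at hcon
            exact hNC w hwN (Or.inr ⟨Φ w, ⟨h1, hcon⟩, Φ.symm_apply_apply w⟩)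
          have hb : Φ w ∈ Metric.ball x₀ ε2 := by
            have := min_le_right ε1 ε2
            rw [Metric.mem_ball, Prod.dist_eq, max_lt_iff, h1, hx1, Subtype.dist_eq, hx2,
              dist_self, Real.dist_eq, abs_lt]
            refine ⟨he2, by linarith, by linarith⟩
          have h3 := hball hb
          simp only [mem_ofPred_eq, Φ.symm_apply_apply] at h3
          linarith [S.Rs_bound hm hm0 w h]
      · have hlt : (w.2 : ℝ) < η + ε := by
          by_contra hcon
          push Not at hcon
          exact hNC w hwN (Or.inl ⟨h1, hcon⟩)
        exact Or.inr ⟨⟨hwN, hwU⟩, Or.inr (htail w h1 h2 (by linarith [min_le_left ε1 ε2]))⟩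
    · rintro w (h | h)
      · exact h.1
      · exact h.1
  · obtain ⟨m1, hm1⟩ := S.eventually_Rs z hzU
    obtain ⟨m2, hm2⟩ := S.eventually_Rs (Φ z) ((hΦU z).2 hzU)
    refine ⟨shiftPt (max m1 m2) z, ⟨hNs _ _ hzN, S.inv _ _ hzU⟩, hm1 _ (le_max_left _ _), ?_⟩
    rw [mem_preimage, hΦs]
    exact hm2 _ (le_max_right _ _)
  · obtain ⟨m1, hm1⟩ := S.eventually_Ls z hzU
    exact ⟨shiftPt m1 z, ⟨hNs _ _ hzN, S.inv _ _ hzU⟩, Or.inl hm1⟩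

end

section
variable {X Um Up : Set Ann}

lemma eac_nX (hX : IsEAC X Um Up) (p : Ann) (h : p.2 = top1 ∨ p.2 = bot1) : p ∉ X := by
  intro hp
  have := hX.inInterior p hp
  rcases h with h | h <;> rw [h] at this
  · exact absurd this.2 (lt_irrefl _)
  · exact absurd this.1 (lt_irrefl _)

lemma eac_top0 (hX : IsEAC X Um Up) : ((0, top1) : Ann) ∈ Up := by
  rw [hX.hUp]
  exact mem_connectedComponentIn (eac_nX hX (0, top1) (Or.inl rfl))

lemma eac_bot0 (hX : IsEAC X Um Up) : ((0, bot1) : Ann) ∈ Um := by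
  rw [hX.hUm]
  exact mem_connectedComponentIn (eac_nX hX (0, bot1) (Or.inr rfl))

lemma eac_Up_sub (hX : IsEAC X Um Up) {D : Set Ann} (hD : IsPreconnected D) (hDX : D ⊆ Xᶜ) {z : Ann} (hz : z ∈ D)
    (hzU : z ∈ Up) : D ⊆ Up := by
  rw [hX.hUp] at hzU ⊢
  exact sub_comp hD hDX hz hzU

lemma eac_Um_sub (hX : IsEAC X Um Up) {D : Set Ann} (hD : IsPreconnected D) (hDX : D ⊆ Xᶜ) {z : Ann} (hz : z ∈ D)
    (hzU : z ∈ Um) : D ⊆ Um := by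
  rw [hX.hUm] at hzU ⊢
  exact sub_comp hD hDX hz hzU

lemma eac_Up_open (hX : IsEAC X Um Up) : IsOpen Up := by
  rw [hX.hUp]; exact hX.compact.isClosed.isOpen_compl.connectedComponentIn

lemma eac_Um_open (hX : IsEAC X Um Up) : IsOpen Um := by
  rw [hX.hUm]; exact hX.compact.isClosed.isOpen_compl.connectedComponentIn

lemma eac_Up_pre (hX : IsEAC X Um Up) : IsPreconnected Up := by
  rw [hX.hUp]; exact isPreconnected_connectedComponentIn

lemma eac_Um_pre (hX : IsEAC X Um Up) : IsPreconnected Um := by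
  rw [hX.hUm]; exact isPreconnected_connectedComponentIn

lemma eac_Up_X (hX : IsEAC X Um Up) : Up ⊆ Xᶜ := by rw [hX.cover]; exact subset_union_right

lemma eac_Um_X (hX : IsEAC X Um Up) : Um ⊆ Xᶜ := by rw [hX.cover]; exact subset_union_left

lemma eac_disj (hX : IsEAC X Um Up) (z : Ann) (h1 : z ∈ Um) (h2 : z ∈ Up) : False := by
  apply hX.ne
  exact subset_antisymm (eac_Up_sub hX (eac_Um_pre hX) (eac_Um_X hX) h1 h2)
    (eac_Um_sub hX (eac_Up_pre hX) (eac_Up_X hX) h2 h1)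

lemma circ_pre (b : II) : IsPreconnected (range fun a : AddCircle (1 : ℝ) => ((a, b) : Ann)) :=
  isPreconnected_range (by fun_prop)

lemma eac_top (hX : IsEAC X Um Up) (a : AddCircle (1 : ℝ)) : ((a, top1) : Ann) ∈ Up :=
  eac_Up_sub hX (circ_pre top1) (by
    rintro _ ⟨a, rfl⟩; exact eac_nX hX _ (Or.inl rfl)) ⟨0, rfl⟩ (eac_top0 hX) ⟨a, rfl⟩

lemma eac_bot (hX : IsEAC X Um Up) (a : AddCircle (1 : ℝ)) : ((a, bot1) : Ann) ∈ Um :=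
  eac_Um_sub hX (circ_pre bot1) (by
    rintro _ ⟨a, rfl⟩; exact eac_nX hX _ (Or.inr rfl)) ⟨0, rfl⟩ (eac_bot0 hX) ⟨a, rfl⟩

lemma eac_N (hX : IsEAC X Um Up) (C : Set Strip) (hC : IsCompact C) (hCU : C ⊆ pr ⁻¹' Up) :
    ∃ N : Set Strip, IsOpen N ∧ IsPreconnected N ∧
      N ∪ pr ⁻¹' Up = univ ∧ (∀ z ∈ N, z ∉ C) ∧
      (∀ (k : ℤ) (z : Strip), z ∈ N → shiftPt k z ∈ N) := by
  set K := pr '' C with hK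
  have hKc : IsCompact K := hC.image pr_cont
  have hKU : K ⊆ Up := by rintro _ ⟨z, hz, rfl⟩; exact hCU hz
  set O := connectedComponentIn Kᶜ ((0, bot1) : Ann) with hO
  have hOo : IsOpen O := hKc.isClosed.isOpen_compl.connectedComponentIn
  obtain ⟨p, hp1, hp2⟩ : (closure Um ∩ X).Nonempty := by
    by_contra hcon
    rw [not_nonempty_iff_eq_empty] at hcon
    have hcl : IsClosed Um := by
      rw [← closure_subset_iff_isClosed]
      intro z hz
      have hzX : z ∈ Xᶜ := fun h => by
        have : z ∈ closure Um ∩ X := ⟨hz, h⟩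
        rw [hcon] at this
        exact this
      rw [hX.cover] at hzX
      rcases hzX with h | h
      · exact h
      · exfalso
        obtain ⟨w, hw1, hw2⟩ := mem_closure_iff.1 hz Up (eac_Up_open hX) h
        exact eac_disj hX w hw2 hw1
    have huniv : Um = univ := IsClopen.eq_univ ⟨hcl, eac_Um_open hX⟩ ⟨_, eac_bot0 hX⟩
    exact eac_disj hX (0, top1) (by rw [huniv]; trivial) (eac_top0 hX)
  have h1 : IsPreconnected (insert p Um) :=
    (eac_Um_pre hX).subset_closure (subset_insert _ _) (insert_subset hp1 subset_closure)
  have h2 : IsPreconnected (insert p Um ∪ X) :=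
    h1.union p (mem_insert _ _) hp2 hX.connected.isPreconnected
  have h3 : insert p Um ∪ X ⊆ O := by
    apply h2.subset_connectedComponentIn (Or.inl (Or.inr (eac_bot0 hX)))
    rintro z hz hzK
    have hzU := hKU hzK
    rcases hz with (rfl | h) | h
    · exact eac_Up_X hX hzU hp2
    · exact eac_disj hX z h hzU
    · exact eac_Up_X hX hzU h
  refine ⟨pr ⁻¹' O, hOo.preimage pr_cont, ?_, ?_, ?_, ?_⟩
  · exact pre_conn O hOo isPreconnected_connectedComponentIn bot1
      (fun a => h3 (Or.inl (Or.inr (eac_bot hX a))))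
  · rw [eq_univ_iff_forall]
    intro z
    by_cases hz : pr z ∈ X
    · exact Or.inl (h3 (Or.inr hz))
    · have hz' : pr z ∈ Xᶜ := hz
      rw [hX.cover] at hz'
      rcases hz' with h | h
      · exact Or.inl (h3 (Or.inl (Or.inr h)))
      · exact Or.inr h
  · intro z hz hzC
    exact connectedComponentIn_subset _ _ hz ⟨z, hzC, rfl⟩
  · intro k z hz
    rw [mem_preimage, pr_shift]
    exact hz

lemma eac_setup (hX : IsEAC X Um Up) {η : ℝ} (hη : etaSpec (pr ⁻¹' X) η) : Setup (pr ⁻¹' Up) η := by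
  obtain ⟨⟨x₀, hx0, hx1, hx2⟩, hmax⟩ := hη
  have hη1 : η < 1 := by
    rw [← hx2]; exact (hX.inInterior _ hx0).2
  refine ⟨(eac_Up_open hX).preimage pr_cont, pre_conn Up (eac_Up_open hX) (eac_Up_pre hX) top1
    (eac_top hX), ?_, ?_, ?_, ?_, hη1⟩
  · intro k z hz
    rw [mem_preimage, pr_shift]
    exact hz
  · intro x
    exact eac_top hX _
  · intro z hz1 hz2
    have hp : IsPreconnected ((fun t : ℝ => pr (0, clamp t)) '' Icc (z.2 : ℝ) 1) :=
      isPreconnected_Icc.image _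
        (pr_cont.comp (continuous_const.prodMk clamp_cont)).continuousOn
    have hval : ∀ t ∈ Icc (z.2 : ℝ) 1, (clamp t : ℝ) = t := fun t ht =>
      clamp_val (z.2.2.1.trans ht.1) ht.2
    refine eac_Up_sub hX hp ?_ (z := (0, top1)) ⟨1, ⟨z.2.2.2, le_rfl⟩, ?_⟩ (eac_top0 hX)
      ⟨z.2, ⟨le_rfl, z.2.2.2⟩, ?_⟩
    · rintro _ ⟨t, ht, rfl⟩ hmem
      have := hmax ⟨(0, clamp t), hmem, rfl, rfl⟩
      rw [hval t ht] at this
      linarith [ht.1]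
    · refine Prod.ext ?_ (Subtype.ext ?_)
      · simp [pr]
      · exact hval 1 ⟨z.2.2.2, le_rfl⟩
    · exact congrArg pr (Prod.ext hz1.symm (Subtype.ext (hval _ ⟨le_rfl, z.2.2.2⟩)))
  · intro z hz1 hz2 hzU
    have : z = x₀ := Prod.ext (hz1.trans hx1.symm) (Subtype.ext (hz2.trans hx2.symm))
    subst this
    exact eac_Up_X hX hzU hx0

lemma eac_f (hX : IsEAC X Um Up) (f : Ann ≃ₜ Ann) (hf : IsotopicToId ⇑f) (hinv : ⇑f '' X = X) (a : Ann) :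
    f a ∈ Up ↔ a ∈ Up := by
  have hXi : ∀ a, f a ∈ X ↔ a ∈ X := by
    intro a
    constructor
    · intro h
      rw [← hinv] at h
      obtain ⟨b, hb, hba⟩ := h
      rwa [← f.injective hba]
    · intro h
      rw [← hinv]
      exact ⟨a, h, rfl⟩
  have himg : ∀ D : Set Ann, D ⊆ Xᶜ → ⇑f '' D ⊆ Xᶜ := by
    rintro D hD _ ⟨b, hb, rfl⟩ h
    exact hD hb ((hXi b).1 h)
  have hUp := (eac_Up_pre hX).image f f.continuous.continuousOn
  have hUm := (eac_Um_pre hX).image f f.continuous.continuousOn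
  have htop0 := eac_top0 hX
  have hbot0 := eac_bot0 hX
  have hcov : ∀ z, z ∉ X → z ∈ Um ∨ z ∈ Up := by
    intro z hz
    have : z ∈ Xᶜ := hz
    rwa [hX.cover] at this
  -- not everything can go to one side
  have hnotUm : (∀ z ∈ Up, f z ∈ Um) → (∀ z ∈ Um, f z ∈ Um) → False := by
    intro h1 h2
    have h3 : f.symm (0, top1) ∉ X := by
      rw [← hXi, f.apply_symm_apply]; exact eac_Up_X hX htop0
    rcases hcov _ h3 with h | h
    · have := h2 _ h
      rw [f.apply_symm_apply] at this
      exact eac_disj hX _ this htop0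
    · have := h1 _ h
      rw [f.apply_symm_apply] at this
      exact eac_disj hX _ this htop0
  have hnotUp : (∀ z ∈ Up, f z ∈ Up) → (∀ z ∈ Um, f z ∈ Up) → False := by
    intro h1 h2
    have h3 : f.symm (0, bot1) ∉ X := by
      rw [← hXi, f.apply_symm_apply]; exact eac_Um_X hX hbot0
    rcases hcov _ h3 with h | h
    · have := h2 _ h
      rw [f.apply_symm_apply] at this
      exact eac_disj hX _ hbot0 this
    · have := h1 _ h
      rw [f.apply_symm_apply] at this
      exact eac_disj hX _ hbot0 this
  have hft : f (0, top1) ∉ X := fun h => eac_Up_X hX htop0 ((hXi _).1 h)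
  have hfb : f (0, bot1) ∉ X := fun h => eac_Um_X hX hbot0 ((hXi _).1 h)
  rcases hcov _ hft with ht | ht
  · exfalso
    have h1 : ∀ z ∈ Up, f z ∈ Um := fun z hz =>
      eac_Um_sub hX hUp (himg _ (eac_Up_X hX)) ⟨_, htop0, rfl⟩ ht ⟨z, hz, rfl⟩
    rcases hcov _ hfb with hb | hb
    · exact hnotUm h1 fun z hz =>
        eac_Um_sub hX hUm (himg _ (eac_Um_X hX)) ⟨_, hbot0, rfl⟩ hb ⟨z, hz, rfl⟩
    · obtain ⟨H, hHc, hHb, hH0, hH1⟩ := hf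
      refine no_swap H hHc (fun t => (hHb t).1) hH0 Up (eac_Up_open hX) (eac_Up_pre hX) htop0
        (by rw [hH1]; exact hb) ?_
      intro a h
      rw [hH1] at h
      exact eac_disj hX _ (h1 _ (eac_top hX a)) h
  · have h1 : ∀ z ∈ Up, f z ∈ Up := fun z hz =>
      eac_Up_sub hX hUp (himg _ (eac_Up_X hX)) ⟨_, htop0, rfl⟩ ht ⟨z, hz, rfl⟩
    rcases hcov _ hfb with hb | hb
    · have h2 : ∀ z ∈ Um, f z ∈ Um := fun z hz =>
        eac_Um_sub hX hUm (himg _ (eac_Um_X hX)) ⟨_, hbot0, rfl⟩ hb ⟨z, hz, rfl⟩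
      refine ⟨fun h => ?_, h1 a⟩
      have h3 : a ∉ X := fun h' => eac_Up_X hX h ((hXi a).2 h')
      rcases hcov a h3 with h' | h'
      · exact (eac_disj hX _ (h2 a h') h).elim
      · exact h'
    · exact (hnotUp h1 fun z hz =>
        eac_Up_sub hX hUm (himg _ (eac_Um_X hX)) ⟨_, hbot0, rfl⟩ hb ⟨z, hz, rfl⟩).elim

end

/-- iterates of a homeomorphism -/
lemma exists_iter (F : Strip ≃ₜ Strip) (n : ℕ) : ∃ Φ : Strip ≃ₜ Strip, ∀ z, Φ z = F^[n] z := by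
  induction n with
  | zero => exact ⟨Homeomorph.refl _, fun z => rfl⟩
  | succ n ih =>
    obtain ⟨Φ, h⟩ := ih
    refine ⟨F.trans Φ, fun z => ?_⟩
    rw [Homeomorph.trans_apply, h, Function.iterate_succ_apply]

lemma lift_shift {f : Ann → Ann} {F : Strip → Strip} (hF : IsLift f F) (k : ℤ) (z : Strip) :
    F (shiftPt k z) = shiftPt k (F z) := by
  have hnat : ∀ (n : ℕ) (z : Strip), F (shiftPt n z) = shiftPt n (F z) := by
    intro n
    induction n with
    | zero => intro z; simp [shift_zero]
    | succ n ih =>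
      intro z
      have h : ∀ w, shiftPt ((n + 1 : ℕ) : ℤ) w = shiftPt 1 (shiftPt n w) := by
        intro w; rw [shift_shift]; push_cast; rfl
      rw [h, hF.2, ih, h]
  rcases Int.eq_nat_or_neg k with ⟨n, rfl | rfl⟩
  · exact hnat n z
  · apply shift_inj n
    rw [← hnat, shift_neg_eq, shift_neg_eq]

theorem main
    (f : Ann ≃ₜ Ann) (hf : IsotopicToId ⇑f)
    (F : Strip ≃ₜ Strip) (hF : IsLift ⇑f ⇑F)
    (X Um Up : Set Ann) (hX : IsEAC X Um Up) (hinv : ⇑f '' X = X)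
    (ρ : ℝ) (hρneg : ρ < 0)
    (hrot : PrimeEndRotB 1 (pr ⁻¹' Up) (pr ⁻¹' X) ⇑F ρ)
    (hdisp : ∀ z ∈ pr ⁻¹' X, (F z).1 ≥ z.1 + 1)
    (η : ℝ) (hη : etaSpec (pr ⁻¹' X) η) :
    ¬ BddBelow (Prod.fst '' Vset (pr ⁻¹' Up) η) := by
  rintro ⟨m', hm'⟩
  have S := eac_setup hX hη
  obtain ⟨⟨x₀, hx0, hx1, hx2⟩, -⟩ := hη
  set m := min m' 0 with hmdef
  have hm : m ∈ lowerBounds (Prod.fst '' Vset (pr ⁻¹' Up) η) := fun y hy =>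
    (min_le_left _ _).trans (hm' hy)
  have hm0 : m ≤ 0 := min_le_right _ _
  choose Φ hΦ using exists_iter F
  have hU : ∀ n z, F^[n] z ∈ pr ⁻¹' Up ↔ z ∈ pr ⁻¹' Up := by
    intro n
    induction n with
    | zero => intro z; rfl
    | succ n ih =>
      intro z
      rw [Function.iterate_succ_apply, ih, mem_preimage, mem_preimage, hF.1, eac_f hX f hf hinv]
  have hXF : ∀ z, F z ∈ pr ⁻¹' X ↔ z ∈ pr ⁻¹' X := by
    intro z
    rw [mem_preimage, mem_preimage, hF.1]
    constructor
    · intro h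
      rw [← hinv] at h
      obtain ⟨b, hb, hba⟩ := h
      rwa [← f.injective hba]
    · intro h
      rw [← hinv]
      exact ⟨_, h, rfl⟩
  have hXn : ∀ n z, F^[n] z ∈ pr ⁻¹' X ↔ z ∈ pr ⁻¹' X := by
    intro n
    induction n with
    | zero => intro z; rfl
    | succ n ih =>
      intro z
      rw [Function.iterate_succ_apply, ih, hXF]
  have hd : ∀ (n : ℕ) z, z ∈ pr ⁻¹' X → z.1 + n ≤ (F^[n] z).1 := by
    intro n
    induction n with
    | zero => intro z _; simp
    | succ n ih =>
      intro z hz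
      rw [Function.iterate_succ_apply]
      have h1 := ih (F z) ((hXF z).2 hz)
      have h2 := hdisp z hz
      push_cast
      linarith
  have hs : ∀ (n : ℕ) (k : ℤ) (z : Strip), F^[n] (shiftPt k z) = shiftPt k (F^[n] z) := by
    intro n k
    induction n with
    | zero => intro z; rfl
    | succ n ih =>
      intro z
      rw [Function.iterate_succ_apply, lift_shift hF, ih, Function.iterate_succ_apply]
  have hΦU : ∀ n z, Φ n z ∈ pr ⁻¹' Up ↔ z ∈ pr ⁻¹' Up := fun n z => by rw [hΦ, hU]
  have hacc := fun n => S.acc hx1 hx2 (Φ n) (hΦU n) (by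
    rw [hΦ]
    have := hd n x₀ hx0
    rw [hx1] at this
    have h2 : (0 : ℝ) ≤ n := Nat.cast_nonneg n
    linarith)
  choose k hk htail using hacc
  have hA : AccFrom (pr ⁻¹' Up) x₀ := ⟨bArc η 0, by
    have := S.bArc_arc hx1 hx2 0
    rwa [shift_zero] at this⟩
  have hlim := hrot x₀ hx0 x₀ hx0 hA hA k (fun n => by rw [← hΦ]; exact hk n)
  have hev : ∀ᶠ n : ℕ in atTop, (k n : ℝ) / (n : ℝ) < 0 := hlim.eventually (gt_mem_nhds hρneg)
  have hev2 : ∀ᶠ n : ℕ in atTop, -m < (n : ℝ) :=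
    tendsto_natCast_atTop_atTop.eventually (eventually_gt_atTop (-m))
  obtain ⟨n, hn1, hn2⟩ := (hev.and hev2).exists
  have hkn : k n < 0 := by
    by_contra hcon
    push Not at hcon
    have h1 : (0 : ℝ) ≤ k n := by exact_mod_cast hcon
    have h2 : (0 : ℝ) ≤ n := Nat.cast_nonneg n
    have := div_nonneg h1 h2
    linarith
  refine S.contra hm hm0 hx1 hx2 (Φ n) (hΦU n) (fun j z => by rw [hΦ, hΦ, hs]) (htail n hkn) ?_
    (eac_N hX)
  have hq : F^[n] ((Φ n).symm x₀) = x₀ := by rw [← hΦ, (Φ n).apply_symm_apply]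
  have hqX : (Φ n).symm x₀ ∈ pr ⁻¹' X := by rw [← hXn n, hq]; exact hx0
  have := hd n _ hqX
  rw [hq, hx1] at this
  linarith


end VU

/-- Case (i) is impossible: under the standing contradiction hypotheses
(`ρ₊ < 0 < inf ρ_mes` and displacement `≥ 1`), `(V)₁` cannot be bounded from below. -/
theorem V_unbounded_below
    (f : Ann ≃ₜ Ann) (hf : IsotopicToId ⇑f)
    (F : Strip ≃ₜ Strip) (hF : IsLift ⇑f ⇑F)
    (X Um Up : Set Ann) (hX : IsEAC X Um Up) (hinv : ⇑f '' X = X)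
    (φ : Ann → ℝ) (hφc : Continuous φ)
    (hφ : ∀ z : Strip, φ (pr z) = (F z).1 - z.1)
    (ρ : ℝ) (hρneg : ρ < 0)
    (hrot : PrimeEndRotB 1 (pr ⁻¹' Up) (pr ⁻¹' X) ⇑F ρ)
    (hpos : 0 < sInf (rotMes ⇑f φ X))
    (hdisp : ∀ z ∈ pr ⁻¹' X, (F z).1 ≥ z.1 + 1)
    (η : ℝ) (hη : etaSpec (pr ⁻¹' X) η) :
    ¬ BddBelow (Prod.fst '' Vset (pr ⁻¹' Up) η) := by
  exact VU.main f hf F hF X Um Up hX hinv ρ hρneg hrot hdisp η hη
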